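/- arXiv:0912.0359 — 3 statements merged into one kernel-verified Lean document; each statement's English description precedes it below -/
import Mathlib

section
/- Assume conditions (1.2) and (2.1), suppose 1/r ∈ L₁(ℝ), and let u, v be a principal fundamental system of solutions of (r z')' = q z. Define ν(x) = r(x) · (∫_{-∞}^x dt/r(t))² · (∫_x^∞ dt/r(t))². If sup_{x∈ℝ} ν(x) < ∞, then for every p ∈ (1,∞) the Green operator G is bounded on L_p(ℝ); if moreover ν(x) → 0 as |x| → ∞, then G : L_p(ℝ) → L_p(ℝ) is compact for every p ∈ (1,∞). -/
open MeasureTheory Filter Topology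
open scoped ENNReal RealInnerProductSpace

noncomputable section

/-- Conditions (1.2): `r, q` measurable, `r > 0`, `q ≥ 0`, with `1/r` and `q`
locally Lebesgue integrable on `ℝ`. -/
def Cond12 (r q : ℝ → ℝ) : Prop :=
  Measurable r ∧ Measurable q ∧ (∀ x, 0 < r x) ∧ (∀ x, 0 ≤ q x) ∧
    LocallyIntegrable (fun t => 1 / r t) volume ∧ LocallyIntegrable q volume

/-- Condition (1.3): for every `x`,
`(∫_{x-d}^x dt/r(t)) · (∫_{x-d}^x q(t) dt) → ∞` as `|d| → ∞`. -/
def Cond13 (r q : ℝ → ℝ) : Prop :=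
  ∀ x : ℝ, Tendsto (fun d : ℝ => (∫ t in x - d..x, 1 / r t) * (∫ t in x - d..x, q t))
    (cocompact ℝ) atTop

/-- Condition (2.1): `∫_{-∞}^x q > 0` and `∫_x^∞ q > 0` for every `x`. -/
def Cond21 (q : ℝ → ℝ) : Prop :=
  ∀ x : ℝ, 0 < ∫⁻ t in Set.Iic x, ENNReal.ofReal (q t) ∧
    0 < ∫⁻ t in Set.Ici x, ENNReal.ofReal (q t)

/-- A principal fundamental system of solutions `u, v` (with a.e. derivatives
`u', v'`) of the equation `(r z')' = q z`:  `u, v, r u', r v'` are locally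
absolutely continuous (expressed through the integral identities below),
`(r u')' = q u` and `(r v')' = q v` a.e., `u > 0`, `v > 0`, `v' ≥ 0`, `u' ≤ 0`,
`r (v' u - u' v) ≡ 1`, `v/u → 0` at `-∞`, `u/v → 0` at `+∞`,
`∫_{-∞}^0 dt/(r u²) < ∞` and `∫_0^∞ dt/(r v²) < ∞`. -/
structure PFSS (r q u v u' v' : ℝ → ℝ) : Prop where
  u_pos : ∀ x, 0 < u x
  v_pos : ∀ x, 0 < v x
  u'_nonpos : ∀ x, u' x ≤ 0
  v'_nonneg : ∀ x, 0 ≤ v' x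
  u'_intble : ∀ a b : ℝ, IntervalIntegrable u' volume a b
  v'_intble : ∀ a b : ℝ, IntervalIntegrable v' volume a b
  u_deriv : ∀ a b : ℝ, u b - u a = ∫ t in a..b, u' t
  v_deriv : ∀ a b : ℝ, v b - v a = ∫ t in a..b, v' t
  ru'_deriv : ∀ a b : ℝ, r b * u' b - r a * u' a = ∫ t in a..b, q t * u t
  rv'_deriv : ∀ a b : ℝ, r b * v' b - r a * v' a = ∫ t in a..b, q t * v t
  wronskian : ∀ x, r x * (v' x * u x - u' x * v x) = 1
  ratio_bot : Tendsto (fun x => v x / u x) atBot (𝓝 0)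
  ratio_top : Tendsto (fun x => u x / v x) atTop (𝓝 0)
  int_u : ∫⁻ t in Set.Iic (0:ℝ), ENNReal.ofReal (1 / (r t * u t ^ 2)) < ⊤
  int_v : ∫⁻ t in Set.Ici (0:ℝ), ENNReal.ofReal (1 / (r t * v t ^ 2)) < ⊤

/-- The Green kernel `G(x,t) = u(x) v(t)` for `x ≥ t`, `u(t) v(x)` for `x ≤ t`. -/
def greenKernel (u v : ℝ → ℝ) (x t : ℝ) : ℝ :=
  if t ≤ x then u x * v t else u t * v x

/-- The space `L_p(ℝ)` (with respect to Lebesgue measure). -/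
abbrev LpR (p : ℝ≥0∞) : Type := Lp ℝ p (volume : Measure ℝ)

/-- `G` is (a bounded realization on `L_p` of) the Green operator
`(G f)(x) = ∫_ℝ G(x,t) f(t) dt`. -/
def IsGreenOp (u v : ℝ → ℝ) (p : ℝ≥0∞) [Fact (1 ≤ p)]
    (G : LpR p →L[ℝ] LpR p) : Prop :=
  ∀ f : LpR p,
    (G f : ℝ → ℝ) =ᵐ[volume] fun x => ∫ t, greenKernel u v x t * (f : ℝ → ℝ) t

/-- `d₁` solves `(∫_{x-d}^x dt/r)(∫_{x-d}^x q dt) = 1`, `d₁ > 0`. -/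
def IsD1 (r q d₁ : ℝ → ℝ) : Prop :=
  ∀ x : ℝ, 0 < d₁ x ∧
    (∫ t in x - d₁ x..x, 1 / r t) * (∫ t in x - d₁ x..x, q t) = 1

/-- `d₂` solves `(∫_x^{x+d} dt/r)(∫_x^{x+d} q dt) = 1`, `d₂ > 0`. -/
def IsD2 (r q d₂ : ℝ → ℝ) : Prop :=
  ∀ x : ℝ, 0 < d₂ x ∧
    (∫ t in x..x + d₂ x, 1 / r t) * (∫ t in x..x + d₂ x, q t) = 1

/-- `φ(x) = ∫_{x-d₁(x)}^x dt/r(t)`. -/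
def phiF (r d₁ : ℝ → ℝ) (x : ℝ) : ℝ := ∫ t in x - d₁ x..x, 1 / r t

/-- `ψ(x) = ∫_x^{x+d₂(x)} dt/r(t)`. -/
def psiF (r d₂ : ℝ → ℝ) (x : ℝ) : ℝ := ∫ t in x..x + d₂ x, 1 / r t

/-- `h(x) = φ(x)ψ(x)/(φ(x)+ψ(x))`. -/
def hF (r d₁ d₂ : ℝ → ℝ) (x : ℝ) : ℝ :=
  phiF r d₁ x * psiF r d₂ x / (phiF r d₁ x + psiF r d₂ x)

/-- `d` solves `∫_{x-d(x)}^{x+d(x)} dt/(r(t)h(t)) = 1`, `d > 0`. -/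
def IsD (r h d : ℝ → ℝ) : Prop :=
  ∀ x : ℝ, 0 < d x ∧ (∫ t in x - d x..x + d x, 1 / (r t * h t)) = 1

/-- `s` solves `∫_{x-s(x)}^{x+s(x)} dt/(r(t)ρ(t)) = 1`, `s > 0`. -/
def IsS (r ρ s : ℝ → ℝ) : Prop :=
  ∀ x : ℝ, 0 < s x ∧ (∫ t in x - s x..x + s x, 1 / (r t * ρ t)) = 1

/-- **Schur's test** with a weight `h`, for nonnegative kernels. -/
theorem lintegral_rpow_le_of_schur {α : Type*} [MeasurableSpace α] {μ : Measure α} [SFinite μ]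
    {p q : ℝ} (hpq : p.HolderConjugate q) {K : α → α → ℝ≥0∞} {h f : α → ℝ≥0∞} {C₁ C₂ : ℝ≥0∞}
    (hK : Measurable (Function.uncurry K)) (hh : Measurable h) (hf : Measurable f)
    (h_ne : ∀ᵐ x ∂μ, h x ≠ 0 ∧ h x ≠ ⊤)
    (h₁ : ∀ᵐ x ∂μ, ∫⁻ t, K x t * h t ^ q ∂μ ≤ C₁ * h x ^ q)
    (h₂ : ∀ᵐ t ∂μ, ∫⁻ x, K x t * h x ^ p ∂μ ≤ C₂ * h t ^ p) :
    ∫⁻ x, (∫⁻ t, K x t * f t ∂μ) ^ p ∂μ ≤ (C₁ ^ (1 / q)) ^ p * C₂ * ∫⁻ t, f t ^ p ∂μ := by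
  have hp := hpq.pos
  have hq := hpq.symm.pos
  have hKx : ∀ x, Measurable (K x) := fun x => hK.comp measurable_prodMk_left
  have hKt : ∀ t, Measurable fun x => K x t := fun t => hK.comp measurable_prodMk_right
  have holder : ∀ᵐ x ∂μ, (∫⁻ t, K x t * f t ∂μ) ^ p ≤
      (C₁ ^ (1 / q)) ^ p * ∫⁻ t, h x ^ p * K x t * (f t * (h t)⁻¹) ^ p ∂μ := by
    filter_upwards [h₁] with x hx
    have e : ∫⁻ t, K x t * f t ∂μ =
        ∫⁻ t, ((fun t => K x t ^ (1 / q) * h t) *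
          fun t => K x t ^ (1 / p) * (f t * (h t)⁻¹)) t ∂μ := by
      refine lintegral_congr_ae ?_
      filter_upwards [h_ne] with t ht
      have e1 : K x t ^ (1 / q) * K x t ^ (1 / p) = K x t := by
        rw [← ENNReal.rpow_add_of_nonneg _ _ (by positivity) (by positivity)]
        have : 1 / q + 1 / p = 1 := by simpa using hpq.symm.inv_add_inv_eq_one
        rw [this, ENNReal.rpow_one]
      have e2 : h t * (h t)⁻¹ = 1 := ENNReal.mul_inv_cancel ht.1 ht.2
      calc K x t * f t = (K x t ^ (1 / q) * K x t ^ (1 / p)) * f t * (h t * (h t)⁻¹) := by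
            rw [e1, e2, mul_one]
        _ = _ := by simp only [Pi.mul_apply]; ring
    rw [e]
    have H := ENNReal.lintegral_mul_le_Lp_mul_Lq μ hpq.symm
      (f := fun t => K x t ^ (1 / q) * h t) (g := fun t => K x t ^ (1 / p) * (f t * (h t)⁻¹))
      ((((hKx x).pow_const _).mul hh).aemeasurable)
      ((((hKx x).pow_const _).mul (hf.mul hh.inv)).aemeasurable)
    have e3 : ∀ t, (K x t ^ (1 / q) * h t) ^ q = K x t * h t ^ q := fun t => by
      rw [ENNReal.mul_rpow_of_nonneg _ _ hq.le, ← ENNReal.rpow_mul, one_div_mul_cancel hq.ne',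
        ENNReal.rpow_one]
    have e4 : ∀ t, (K x t ^ (1 / p) * (f t * (h t)⁻¹)) ^ p = K x t * (f t * (h t)⁻¹) ^ p :=
      fun t => by
      rw [ENNReal.mul_rpow_of_nonneg _ _ hp.le, ← ENNReal.rpow_mul, one_div_mul_cancel hp.ne',
        ENNReal.rpow_one]
    simp only [e3, e4] at H
    refine (ENNReal.rpow_le_rpow H hp.le).trans ?_
    rw [ENNReal.mul_rpow_of_nonneg _ _ hp.le, ← ENNReal.rpow_mul _ (1 / p) p,
      one_div_mul_cancel hp.ne', ENNReal.rpow_one]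
    have e5 : (∫⁻ t, K x t * h t ^ q ∂μ) ^ (1 / q) ≤ C₁ ^ (1 / q) * h x := by
      refine (ENNReal.rpow_le_rpow hx (by positivity)).trans_eq ?_
      rw [ENNReal.mul_rpow_of_nonneg _ _ (by positivity), ← ENNReal.rpow_mul,
        mul_one_div_cancel hq.ne', ENNReal.rpow_one]
    refine (mul_le_mul_left (ENNReal.rpow_le_rpow e5 hp.le) _).trans_eq ?_
    rw [ENNReal.mul_rpow_of_nonneg _ _ hp.le, mul_assoc]
    congr 1
    simp only [mul_assoc]
    rw [lintegral_const_mul]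
    exact (hKx x).mul ((hf.mul hh.inv).pow_const _)
  have hm : Measurable (Function.uncurry fun x t => h x ^ p * K x t * (f t * (h t)⁻¹) ^ p) :=
    (((hh.comp measurable_fst).pow_const _).mul hK).mul
      (((hf.mul hh.inv).comp measurable_snd).pow_const _)
  refine (lintegral_mono_ae holder).trans ?_
  rw [lintegral_const_mul _ hm.lintegral_prod_right, mul_assoc,
    lintegral_lintegral_swap hm.aemeasurable, ← lintegral_const_mul _ (hf.pow_const _)]
  refine mul_le_mul_right (lintegral_mono_ae ?_) _
  filter_upwards [h₂, h_ne] with t ht hne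
  rw [lintegral_mul_const _ (show Measurable fun x => h x ^ p * K x t from
    (hh.pow_const _).mul (hKt t))]
  simp only [mul_comm (h _ ^ p) _]
  refine (mul_le_mul_left ht _).trans_eq ?_
  rw [mul_assoc, ← ENNReal.mul_rpow_of_nonneg _ _ hp.le, mul_left_comm,
    ENNReal.mul_inv_cancel hne.1 hne.2, mul_one]

theorem lintegral_comp_abs_le {g : ℝ → ℝ≥0∞} (hg : Measurable g) :
    ∫⁻ t, g |t| ≤ 2 * ∫⁻ t in Set.Ioi 0, g t := by
  have hI : ∫⁻ t in Set.Ioi 0, g |t| = ∫⁻ t in Set.Ioi 0, g t :=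
    setLIntegral_congr_fun measurableSet_Ioi fun t ht => by rw [abs_of_pos ht]
  have hN : ∫⁻ t in Set.Iio 0, g |t| = ∫⁻ t in Set.Ioi 0, g |t| := by
    have := (Measure.measurePreserving_neg (volume : Measure ℝ)).setLIntegral_comp_preimage
      (s := Set.Ioi 0) measurableSet_Ioi (f := fun t => g |t|) (hg.comp measurable_id.abs)
    simpa using this
  rw [← lintegral_add_compl _ (measurableSet_Ioi (a := (0 : ℝ))), Set.compl_Ioi,
    setLIntegral_congr Iio_ae_eq_Iic.symm, hN, hI, two_mul]

theorem lintegral_inv_max_mul_rpow_le {b : ℝ} (hb0 : 0 < b) (hb1 : b < 1) {x : ℝ} (hx : x ≠ 0) :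
    ∫⁻ t, ENNReal.ofReal (max |x| |t|)⁻¹ * ENNReal.ofReal (|t| ^ (-b)) ≤
      (2 * ENNReal.ofReal (1 / (1 - b) + 1 / b)) * ENNReal.ofReal (|x| ^ (-b)) := by
  have hy : 0 < |x| := abs_pos.2 hx
  generalize |x| = y at hy
  have hg : Measurable fun t : ℝ => ENNReal.ofReal (max y t)⁻¹ * ENNReal.ofReal (t ^ (-b)) := by
    fun_prop
  refine (lintegral_comp_abs_le hg).trans ?_
  rw [mul_assoc]
  refine mul_le_mul_right ?_ _
  have h1 : ∫⁻ t in Set.Ioc 0 y, ENNReal.ofReal (max y t)⁻¹ * ENNReal.ofReal (t ^ (-b)) =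
      ENNReal.ofReal (y ^ (-b) * (1 / (1 - b))) := by
    have hint : IntegrableOn (fun t : ℝ => t ^ (-b)) (Set.Ioc 0 y) := by
      rw [← intervalIntegrable_iff_integrableOn_Ioc_of_le hy.le]
      exact intervalIntegral.intervalIntegrable_rpow' (by linarith)
    calc _ = ∫⁻ t in Set.Ioc 0 y, ENNReal.ofReal (y⁻¹) * ENNReal.ofReal (t ^ (-b)) :=
          setLIntegral_congr_fun measurableSet_Ioc fun t ht => by rw [max_eq_left ht.2]
      _ = ENNReal.ofReal y⁻¹ * ENNReal.ofReal (∫ t in Set.Ioc 0 y, t ^ (-b)) := by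
          rw [lintegral_const_mul _ (by fun_prop), ofReal_integral_eq_lintegral_ofReal hint]
          exact (ae_restrict_iff' measurableSet_Ioc).2 <| .of_forall fun t ht =>
            Real.rpow_nonneg ht.1.le _
      _ = _ := by
          rw [← intervalIntegral.integral_of_le hy.le, integral_rpow (Or.inl (by linarith)),
            ← ENNReal.ofReal_mul (by positivity), Real.zero_rpow (by linarith),
            Real.rpow_add hy, Real.rpow_one]
          congr 1
          have : 1 - b ≠ 0 := by linarith
          rw [show -b + 1 = 1 - b by ring]
          field_simp
          ring
  have h2 : ∫⁻ t in Set.Ioi y, ENNReal.ofReal (max y t)⁻¹ * ENNReal.ofReal (t ^ (-b)) =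
      ENNReal.ofReal (y ^ (-b) * (1 / b)) := by
    calc _ = ∫⁻ t in Set.Ioi y, ENNReal.ofReal (t ^ (-b - 1)) :=
          setLIntegral_congr_fun measurableSet_Ioi fun t ht => by
            have ht' : 0 < t := hy.trans ht
            simp only [max_eq_right (le_of_lt (show y < t from ht))]
            rw [← ENNReal.ofReal_mul (by positivity), Real.rpow_sub ht', Real.rpow_one,
              div_eq_inv_mul]
      _ = ENNReal.ofReal (∫ t in Set.Ioi y, t ^ (-b - 1)) := by
          rw [ofReal_integral_eq_lintegral_ofReal
            (integrableOn_Ioi_rpow_of_lt (by linarith) hy)]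
          exact (ae_restrict_iff' measurableSet_Ioi).2 <| .of_forall fun t ht =>
            Real.rpow_nonneg (hy.trans ht).le _
      _ = _ := by
          rw [integral_Ioi_rpow_of_lt (by linarith) hy]
          congr 1
          rw [show -b - 1 + 1 = -b by ring, neg_div_neg_eq, mul_one_div]
  rw [← Set.Ioc_union_Ioi_eq_Ioi hy.le,
    lintegral_union measurableSet_Ioi (Set.Ioc_disjoint_Ioi le_rfl), h1, h2,
    ← ENNReal.ofReal_add (by have : 0 < 1 - b := by linarith
                             positivity) (by positivity),
    ← ENNReal.ofReal_mul (by have : 0 < 1 - b := by linarith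
                             positivity)]
  exact ENNReal.ofReal_le_ofReal (by ring_nf; rfl)

/-- The kernel `1 / max(|x|, |t|)` acts boundedly on `L_p(ℝ)`. -/
theorem exists_lintegral_inv_max_rpow_le {p : ℝ} (hp : 1 < p) :
    ∃ C : ℝ≥0∞, C ≠ ⊤ ∧ ∀ f : ℝ → ℝ≥0∞, Measurable f →
      ∫⁻ x, (∫⁻ t, ENNReal.ofReal (max |x| |t|)⁻¹ * f t) ^ p ≤ C * ∫⁻ t, f t ^ p := by
  have hpq : p.HolderConjugate p.conjExponent := .conjExponent hp
  set q := p.conjExponent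
  have hp0 := hpq.pos
  have hq0 := hpq.symm.pos
  have hsum := hpq.inv_add_inv_eq_one
  have hpi : 0 < p⁻¹ := inv_pos.2 hp0
  have hqi : 0 < q⁻¹ := inv_pos.2 hq0
  have ae0 : ∀ᵐ x : ℝ, x ≠ 0 := by simp [ae_iff]
  have hpow : ∀ x : ℝ, x ≠ 0 → ∀ s : ℝ,
      ENNReal.ofReal (|x| ^ (-(p⁻¹ * q⁻¹))) ^ s = ENNReal.ofReal (|x| ^ (-(p⁻¹ * q⁻¹ * s))) := by
    intro x hx s
    have hx' := abs_pos.2 hx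
    rw [ENNReal.ofReal_rpow_of_pos (by positivity), ← Real.rpow_mul hx'.le, neg_mul]
  have eq : p⁻¹ * q⁻¹ * q = p⁻¹ := by field_simp
  have ep : p⁻¹ * q⁻¹ * p = q⁻¹ := by field_simp
  refine ⟨((2 * ENNReal.ofReal (1 / (1 - p⁻¹) + 1 / p⁻¹)) ^ (1 / q)) ^ p *
    (2 * ENNReal.ofReal (1 / (1 - q⁻¹) + 1 / q⁻¹)), ?_, fun f hf => ?_⟩
  · refine ENNReal.mul_ne_top (ENNReal.rpow_ne_top_of_nonneg hp0.le
      (ENNReal.rpow_ne_top_of_nonneg (by positivity) ?_)) ?_ <;>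
    exact ENNReal.mul_ne_top (by simp) ENNReal.ofReal_ne_top
  refine lintegral_rpow_le_of_schur hpq (h := fun x => ENNReal.ofReal (|x| ^ (-(p⁻¹ * q⁻¹))))
    (by unfold Function.uncurry; fun_prop) (by fun_prop) hf ?_ ?_ ?_
  · filter_upwards [ae0] with x hx
    have hx' := abs_pos.2 hx
    exact ⟨by simpa using Real.rpow_pos_of_pos hx' _, ENNReal.ofReal_ne_top⟩
  · filter_upwards [ae0] with x hx
    rw [hpow x hx, eq]
    refine (lintegral_congr_ae ?_).trans_le
      (lintegral_inv_max_mul_rpow_le hpi (by linarith) hx)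
    filter_upwards [ae0] with t ht
    rw [hpow t ht, eq]
  · filter_upwards [ae0] with x hx
    rw [hpow x hx, ep]
    refine (lintegral_congr_ae ?_).trans_le
      (lintegral_inv_max_mul_rpow_le hqi (by linarith) hx)
    filter_upwards [ae0] with t ht
    rw [hpow t ht, ep, max_comm]

/-- Integral operators whose kernel is dominated by `B / max(|x|, |t|)` are well defined on
`L_p(ℝ)`, with a bound linear in `B`. -/
theorem exists_eLpNorm_integral_le_of_max_mul_abs_le {p : ℝ≥0∞} (hp1 : 1 < p) (hp2 : p ≠ ⊤) :
    ∃ C : NNReal, ∀ k : ℝ → ℝ → ℝ, Measurable (Function.uncurry k) → ∀ B : NNReal,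
      (∀ x t, max |x| |t| * |k x t| ≤ B) → ∀ f : LpR p,
        (∀ᵐ x, Integrable fun t => k x t * (f : ℝ → ℝ) t) ∧
        eLpNorm (fun x => ∫ t, k x t * (f : ℝ → ℝ) t) p ≤ (C * B : NNReal) * eLpNorm f p := by
  have hp0 : p ≠ 0 := (zero_lt_one.trans hp1).ne'
  have hpr : 1 < p.toReal := by
    rw [← ENNReal.toReal_one]; exact (ENNReal.toReal_lt_toReal ENNReal.one_ne_top hp2).2 hp1
  have hpr0 : 0 < p.toReal := by linarith
  obtain ⟨C, hC, hCf⟩ := exists_lintegral_inv_max_rpow_le hpr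
  have hC' : C ^ (1 / p.toReal) ≠ ⊤ := ENNReal.rpow_ne_top_of_nonneg (by positivity) hC
  refine ⟨(C ^ (1 / p.toReal)).toNNReal, fun k hk B hB f => ?_⟩
  have hf : Measurable (f : ℝ → ℝ) := (Lp.stronglyMeasurable f).measurable
  have hkf : ∀ x, Measurable fun t => k x t * (f : ℝ → ℝ) t := fun x =>
    (hk.comp measurable_prodMk_left).mul hf
  have hpt : ∀ x : ℝ, x ≠ 0 → ∫⁻ t, ‖k x t * (f : ℝ → ℝ) t‖ₑ ≤
      B * ∫⁻ t, ENNReal.ofReal (max |x| |t|)⁻¹ * ‖(f : ℝ → ℝ) t‖ₑ := by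
    intro x hx
    rw [← lintegral_const_mul _ (by fun_prop)]
    refine lintegral_mono fun t => ?_
    simp only [enorm_mul]
    rw [← mul_assoc]
    refine mul_le_mul_left ?_ _
    have hm : 0 < max |x| |t| := lt_max_of_lt_left (abs_pos.2 hx)
    rw [← ENNReal.ofReal_coe_nnreal, ← ENNReal.ofReal_mul B.coe_nonneg, ← ofReal_norm,
      Real.norm_eq_abs]
    refine ENNReal.ofReal_le_ofReal ?_
    rw [← div_eq_mul_inv, le_div_iff₀ hm, mul_comm]
    exact hB x t
  have ae0 : ∀ᵐ x : ℝ, x ≠ 0 := by simp [ae_iff]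
  have hS := hCf (fun t => ‖(f : ℝ → ℝ) t‖ₑ) hf.enorm
  have hfin : ∫⁻ t, ‖(f : ℝ → ℝ) t‖ₑ ^ p.toReal ≠ ⊤ :=
    (lintegral_rpow_enorm_lt_top_of_eLpNorm_lt_top hp0 hp2 (Lp.eLpNorm_lt_top f)).ne
  refine ⟨?_, ?_⟩
  · have hmeas : Measurable fun x : ℝ =>
        (∫⁻ t, ENNReal.ofReal (max |x| |t|)⁻¹ * ‖(f : ℝ → ℝ) t‖ₑ) ^ p.toReal := by
      refine (Measurable.lintegral_prod_right ?_).pow_const _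
      unfold Function.uncurry; fun_prop
    filter_upwards [ae0, ae_lt_top hmeas (hS.trans_lt
      (ENNReal.mul_lt_top hC.lt_top hfin.lt_top)).ne] with x hx hx'
    refine ⟨(hkf x).aestronglyMeasurable, (hpt x hx).trans_lt
      (ENNReal.mul_lt_top ENNReal.coe_lt_top ?_)⟩
    exact (ENNReal.rpow_lt_top_iff_of_pos hpr0).1 hx'
  · rw [eLpNorm_eq_lintegral_rpow_enorm_toReal hp0 hp2,
      eLpNorm_eq_lintegral_rpow_enorm_toReal hp0 hp2, ENNReal.coe_mul,
      ENNReal.coe_toNNReal hC']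
    have h1 : ∫⁻ x, ‖∫ t, k x t * (f : ℝ → ℝ) t‖ₑ ^ p.toReal ≤
        (B : ℝ≥0∞) ^ p.toReal * (C * ∫⁻ t, ‖(f : ℝ → ℝ) t‖ₑ ^ p.toReal) := by
      refine le_trans ?_ (mul_le_mul_right hS _)
      rw [← lintegral_const_mul' _ _ (ENNReal.rpow_ne_top_of_nonneg hpr0.le ENNReal.coe_ne_top)]
      refine lintegral_mono_ae ?_
      filter_upwards [ae0] with x hx
      rw [← ENNReal.mul_rpow_of_nonneg _ _ hpr0.le]
      exact ENNReal.rpow_le_rpow ((enorm_integral_le_lintegral_enorm _).trans (hpt x hx)) hpr0.le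
    refine (ENNReal.rpow_le_rpow h1 (by positivity)).trans_eq ?_
    rw [ENNReal.mul_rpow_of_nonneg _ _ (by positivity), ENNReal.mul_rpow_of_nonneg _ _ (by positivity),
      ← ENNReal.rpow_mul, mul_one_div_cancel hpr0.ne', ENNReal.rpow_one]
    ring

/-- The kernel `k` defines a bounded integral operator on `L_p(ℝ)`, with operator norm controlled
by `sup max(|x|, |t|) |k(x, t)|`; the same control holds for differences of such operators. -/
theorem exists_clm_of_max_mul_abs_le {p : ℝ≥0∞} [Fact (1 ≤ p)] (hp1 : 1 < p) (hp2 : p ≠ ⊤) :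
    ∃ C : NNReal, ∀ k : ℝ → ℝ → ℝ, Measurable (Function.uncurry k) → ∀ B : NNReal,
      (∀ x t, max |x| |t| * |k x t| ≤ B) →
      ∃ T : LpR p →L[ℝ] LpR p,
        (∀ f : LpR p, (T f : ℝ → ℝ) =ᵐ[volume] fun x => ∫ t, k x t * (f : ℝ → ℝ) t) ∧
        ∀ k' : ℝ → ℝ → ℝ, Measurable (Function.uncurry k') → ∀ B' ε : NNReal,
          (∀ x t, max |x| |t| * |k' x t| ≤ B') →
          (∀ x t, max |x| |t| * |k x t - k' x t| ≤ ε) → ∀ T' : LpR p →L[ℝ] LpR p,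
          (∀ f : LpR p, (T' f : ℝ → ℝ) =ᵐ[volume] fun x => ∫ t, k' x t * (f : ℝ → ℝ) t) →
          ‖T - T'‖ ≤ C * ε := by
  obtain ⟨C, hC⟩ := exists_eLpNorm_integral_le_of_max_mul_abs_le hp1 hp2
  refine ⟨C, fun k hk B hB => ?_⟩
  have hmem : ∀ f : LpR p, MemLp (fun x => ∫ t, k x t * (f : ℝ → ℝ) t) p volume := fun f => by
    refine ⟨StronglyMeasurable.aestronglyMeasurable ?_, ((hC k hk B hB f).2).trans_lt
      (ENNReal.mul_lt_top ENNReal.coe_lt_top (Lp.eLpNorm_lt_top f))⟩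
    refine StronglyMeasurable.integral_prod_right (Measurable.stronglyMeasurable ?_)
    exact hk.mul ((Lp.stronglyMeasurable f).measurable.comp measurable_snd)
  let L : LpR p →ₗ[ℝ] LpR p :=
    { toFun := fun f => (hmem f).toLp
      map_add' := fun f g => by
        refine Lp.ext ?_
        filter_upwards [(hmem (f + g)).coeFn_toLp, (hmem f).coeFn_toLp, (hmem g).coeFn_toLp,
          Lp.coeFn_add (hmem f).toLp (hmem g).toLp, (hC k hk B hB f).1, (hC k hk B hB g).1]
          with x h1 h2 h3 h4 h5 h6
        rw [h4, Pi.add_apply, h1, h2, h3, ← integral_add h5 h6]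
        refine integral_congr_ae ?_
        filter_upwards [Lp.coeFn_add f g] with t ht
        rw [ht, Pi.add_apply, mul_add]
      map_smul' := fun c f => by
        refine Lp.ext ?_
        filter_upwards [(hmem (c • f)).coeFn_toLp, (hmem f).coeFn_toLp,
          Lp.coeFn_smul c (hmem f).toLp] with x h1 h2 h3
        rw [RingHom.id_apply, h3, Pi.smul_apply, h1, h2, smul_eq_mul, ← integral_const_mul]
        refine integral_congr_ae ?_
        filter_upwards [Lp.coeFn_smul c f] with t ht
        rw [ht, Pi.smul_apply, smul_eq_mul, mul_left_comm] }
  have hL : ∀ f, ‖L f‖ ≤ C * B * ‖f‖ := fun f => by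
    change ‖(hmem f).toLp‖ ≤ _
    rw [Lp.norm_toLp, Lp.norm_def, ← NNReal.coe_mul, ← ENNReal.coe_toReal, ← ENNReal.toReal_mul]
    exact ENNReal.toReal_mono (ENNReal.mul_ne_top ENNReal.coe_ne_top (Lp.eLpNorm_ne_top f))
      (hC k hk B hB f).2
  refine ⟨L.mkContinuous (C * B) hL, fun f => (hmem f).coeFn_toLp, ?_⟩
  intro k' hk' B' ε hB' hε T' hT'
  refine ContinuousLinearMap.opNorm_le_bound _ (by positivity) fun f => ?_
  have e : (((L.mkContinuous (C * B) hL - T') f : LpR p) : ℝ → ℝ) =ᵐ[volume]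
      fun x => ∫ t, (k x t - k' x t) * (f : ℝ → ℝ) t := by
    filter_upwards [Lp.coeFn_sub (hmem f).toLp (T' f), (hmem f).coeFn_toLp, hT' f,
      (hC k hk B hB f).1, (hC k' hk' B' hB' f).1] with x h1 h2 h3 h4 h5
    refine h1.trans ?_
    rw [Pi.sub_apply, h2, h3, ← integral_sub h4 h5]
    simp only [sub_mul]
  rw [Lp.norm_def, Lp.norm_def, eLpNorm_congr_ae e, ← NNReal.coe_mul, ← ENNReal.coe_toReal,
    ← ENNReal.toReal_mul]
  exact ENNReal.toReal_mono (ENNReal.mul_ne_top ENNReal.coe_ne_top (Lp.eLpNorm_ne_top f))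
    (hC (fun x t => k x t - k' x t) (hk.sub hk') ε hε f).2

theorem isCompactOperator_of_forall_mem_finiteDimensional {E F : Type*} [NormedAddCommGroup E]
    [NormedSpace ℝ E] [NormedAddCommGroup F] [NormedSpace ℝ F] (T : E →L[ℝ] F)
    (S : Submodule ℝ F) [FiniteDimensional ℝ S] (h : ∀ x, T x ∈ S) : IsCompactOperator T := by
  have : ProperSpace S := FiniteDimensional.proper ℝ S
  have h1 : IsCompactOperator (T.codRestrict S h) :=
    isCompactOperator_of_locallyCompactSpace_dom (T.codRestrict S h)
  exact h1.clm_comp S.subtypeL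

/-- A kernel that depends on `x` only through finitely many cells of finite measure gives a compact
operator. -/
theorem isCompactOperator_of_step_kernel {p : ℝ≥0∞} [Fact (1 ≤ p)] {ι : Type*} [Fintype ι]
    (s : ι → Set ℝ) (hs : ∀ i, MeasurableSet (s i)) (hs' : ∀ i, volume (s i) ≠ ⊤)
    (c : ι → LpR p → ℝ) (T : LpR p →L[ℝ] LpR p)
    (hT : ∀ f : LpR p, (T f : ℝ → ℝ) =ᵐ[volume] fun x => ∑ i, (s i).indicator (fun _ => c i f) x) :
    IsCompactOperator T := by
  have := FiniteDimensional.span_of_finite ℝ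
    (Set.finite_range fun i => indicatorConstLp p (hs i) (hs' i) (1 : ℝ))
  refine isCompactOperator_of_forall_mem_finiteDimensional T
    (Submodule.span ℝ (Set.range fun i => indicatorConstLp p (hs i) (hs' i) (1 : ℝ))) fun f => ?_
  have : T f = ∑ i, c i f • indicatorConstLp p (hs i) (hs' i) (1 : ℝ) := by
    refine Lp.ext ((hT f).trans ?_)
    have h1 : ∀ᵐ x, ∀ i, (c i f • indicatorConstLp p (hs i) (hs' i) (1 : ℝ) : LpR p) x =
        (s i).indicator (fun _ => c i f) x := by
      rw [ae_all_iff]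
      intro i
      filter_upwards [Lp.coeFn_smul (c i f) (indicatorConstLp p (hs i) (hs' i) (1 : ℝ)),
        indicatorConstLp_coeFn (p := p) (hs := hs i) (hμs := hs' i) (c := (1 : ℝ))] with x h2 h3
      rw [h2, Pi.smul_apply, h3]
      by_cases hx : x ∈ s i <;> simp [hx]
    filter_upwards [h1, Lp.coeFn_finsetSum Finset.univ
      fun i => c i f • indicatorConstLp p (hs i) (hs' i) (1 : ℝ)] with x h2 h3
    rw [h3, Finset.sum_apply]
    exact Finset.sum_congr rfl fun i _ => (h2 i).symm
  rw [this]
  exact Submodule.sum_mem _ fun i _ => Submodule.smul_mem _ _ (Submodule.subset_span ⟨i, rfl⟩)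

/-- A bounded integral operator with continuous kernel `k` such that
`max(|x|, |t|) k(x, t) → 0` at infinity is compact on `L_p(ℝ)`. -/
theorem isCompactOperator_of_max_mul_abs_tendsto {p : ℝ≥0∞} [Fact (1 ≤ p)] (hp1 : 1 < p)
    (hp2 : p ≠ ⊤) {k : ℝ → ℝ → ℝ} (hk : Continuous (Function.uncurry k)) {B : NNReal}
    (hB : ∀ x t, max |x| |t| * |k x t| ≤ B)
    (hdecay : ∀ ε > 0, ∃ N : ℕ, ∀ x t, (N : ℝ) ≤ max |x| |t| → max |x| |t| * |k x t| ≤ ε)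
    {T : LpR p →L[ℝ] LpR p}
    (hT : ∀ f : LpR p, (T f : ℝ → ℝ) =ᵐ[volume] fun x => ∫ t, k x t * (f : ℝ → ℝ) t) :
    IsCompactOperator T := by
  obtain ⟨C, hC⟩ := exists_clm_of_max_mul_abs_le hp1 hp2
  have hclosed := isClosed_setOfPred_isCompactOperator (𝕜₁ := ℝ) (𝕜₂ := ℝ)
    (σ₁₂ := RingHom.id ℝ) (M₁ := LpR p) (M₂ := LpR p)
  suffices h : T ∈ closure {f : LpR p →L[ℝ] LpR p | IsCompactOperator f} by
    rwa [hclosed.closure_eq] at h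
  refine Metric.mem_closure_iff.2 fun δ hδ => ?_
  obtain ⟨ε, hε, hεδ⟩ : ∃ ε : NNReal, 0 < (ε : ℝ) ∧ C * (ε : ℝ) < δ := by
    refine ⟨(δ / (C + 1)).toNNReal, ?_, ?_⟩ <;> rw [Real.coe_toNNReal _ (by positivity)]
    · positivity
    rw [mul_div_assoc', div_lt_iff₀ (by positivity)]
    nlinarith
  obtain ⟨N₀, hN₀⟩ := hdecay ε hε
  obtain ⟨N, hN1, hN⟩ : ∃ N : ℕ, 0 < (N : ℝ) ∧
      ∀ x t, (N : ℝ) ≤ max |x| |t| → max |x| |t| * |k x t| ≤ ε :=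
    ⟨N₀ + 1, by positivity, fun x t h => hN₀ x t (le_trans (by simp) h)⟩
  have huc := (isCompact_Icc.prod isCompact_Icc).uniformContinuousOn_of_continuous
    (s := Set.Icc (-(N + 1) : ℝ) (N + 1) ×ˢ Set.Icc (-(N + 1) : ℝ) (N + 1)) hk.continuousOn
  obtain ⟨η, hη, hηk⟩ := Metric.uniformContinuousOn_iff.1 huc (ε / N) (by positivity)
  obtain ⟨n, hn⟩ := exists_nat_one_div_lt hη
  obtain ⟨m, hm1, hmη⟩ : ∃ m : ℕ, (1 : ℝ) ≤ m ∧ 1 / (m : ℝ) < η :=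
    ⟨n + 1, by simp, by simpa using hn⟩
  have hm0 : (0 : ℝ) < m := by linarith
  let k' : ℝ → ℝ → ℝ := fun x t => if max |x| |t| < N then k (⌊x * m⌋ / m) t else 0
  have hk' : Measurable (Function.uncurry k') := by
    refine Measurable.ite ?_ ?_ measurable_const
    · exact measurableSet_lt (by fun_prop) measurable_const
    · refine hk.measurable.comp (Measurable.prodMk ?_ measurable_snd)
      exact ((measurable_from_top (f := fun n : ℤ => (n : ℝ))).comp
        (Int.measurable_floor.comp (measurable_fst.mul_const _))).div_const _
  have hdiff : ∀ x t, max |x| |t| * |k' x t - k x t| ≤ ε := by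
    intro x t
    by_cases h : max |x| |t| < N
    · have hx := abs_lt.1 ((le_max_left _ _).trans_lt h)
      have ht := abs_lt.1 ((le_max_right _ _).trans_lt h)
      have hfl : (⌊x * m⌋ : ℝ) / m ≤ x := by
        rw [div_le_iff₀ hm0]; exact Int.floor_le _
      have hfl' : x - (⌊x * m⌋ : ℝ) / m < 1 / m := by
        rw [sub_lt_iff_lt_add, ← add_div, lt_div_iff₀ hm0, add_comm]
        exact Int.lt_floor_add_one _
      have h1m : 1 / (m : ℝ) ≤ 1 := by
        rw [div_le_one hm0]; exact hm1
      have := hηk (⌊x * m⌋ / m, t) ⟨⟨by linarith, by linarith⟩, ⟨by linarith, by linarith⟩⟩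
        (x, t) ⟨⟨by linarith, by linarith⟩, ⟨by linarith, by linarith⟩⟩ (by
          rw [Prod.dist_eq, dist_self, max_eq_left dist_nonneg, Real.dist_eq, abs_sub_comm,
            abs_of_nonneg (by linarith)]
          linarith)
      rw [Real.dist_eq] at this
      simp only [k', if_pos h]
      calc _ ≤ (N : ℝ) * (ε / N) := by
            refine mul_le_mul h.le this.le (abs_nonneg _) hN1.le
        _ = ε := by field_simp
    · simp only [k', if_neg h, zero_sub, abs_neg]
      exact hN x t (not_lt.1 h)
  have hB' : ∀ x t, max |x| |t| * |k' x t| ≤ (B + ε : NNReal) := by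
    intro x t
    have h1 : |k' x t| ≤ |k x t| + |k' x t - k x t| := by
      have := abs_add_le (k x t) (k' x t - k x t)
      simpa using this
    have h2 : 0 ≤ max |x| |t| := (abs_nonneg _).trans (le_max_left _ _)
    have := mul_le_mul_of_nonneg_left h1 h2
    push_cast
    linarith [hB x t, hdiff x t]
  obtain ⟨T', hT', hTT'⟩ := hC k' hk' (B + ε) hB'
  refine ⟨T', ?_, ?_⟩
  · let M : ℤ := N * m
    let s : Finset.Icc (-M) M → Set ℝ := fun j => {x | |x| < N ∧ ⌊x * m⌋ = (j : ℤ)}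
    refine isCompactOperator_of_step_kernel s (fun j => ?_) (fun j => ?_)
      (fun j f => ∫ t : ℝ, if |t| < N then k ((j : ℤ) / m) t * (f : ℝ → ℝ) t else 0) T' fun f => ?_
    · exact (measurableSet_lt (measurable_id.abs) measurable_const :
        MeasurableSet {x : ℝ | |x| < N}).inter
        (measurableSet_eq_fun (Int.measurable_floor.comp (measurable_id.mul_const _))
          measurable_const)
    · refine ne_top_of_le_ne_top ?_ (measure_mono (t := Set.Icc (-(N : ℝ)) N) fun x hx =>
        abs_le.1 hx.1.le)
      simp
    · refine (hT' f).trans (.of_forall fun x => ?_)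
      by_cases hx : |x| < N
      · have hx' := abs_lt.1 hx
        have hj : ⌊x * m⌋ ∈ Finset.Icc (-M) M := by
          rw [Finset.mem_Icc]
          refine ⟨Int.le_floor.2 ?_, Int.floor_le_iff.2 ?_⟩
          · simp only [M]; push_cast; nlinarith
          · simp only [M]; push_cast; nlinarith
        dsimp only
        rw [Finset.sum_eq_single ⟨_, hj⟩]
        · rw [Set.indicator_of_mem (show x ∈ s ⟨_, hj⟩ from ⟨hx, rfl⟩)]
          refine integral_congr_ae (.of_forall fun t => ?_)
          simp [k', hx]
        · intro j _ hne
          refine Set.indicator_of_notMem (fun hxj => hne ?_) _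
          exact Subtype.ext hxj.2.symm
        · simp
      · dsimp only
        rw [Finset.sum_eq_zero fun j _ => Set.indicator_of_notMem (fun h => hx h.1) _]
        simp [k', hx]
  · rw [dist_comm, dist_eq_norm]
    exact (hTT' k hk.measurable B ε hB hdiff T hT).trans_lt hεδ

/-- If `Q` is positive, decreasing and `-Q' ≥ c Q²` in integrated form, then `Q` decays at least
like `1 / (c y)`. -/
theorem mul_sub_mul_le_one_of_riccati {Q : ℝ → ℝ} (hQc : Continuous Q) (hQ : ∀ x, 0 < Q x)
    {c a : ℝ} (h : ∀ x y, a ≤ x → x ≤ y → c * (y - x) * Q y ^ 2 ≤ Q x - Q y) {y : ℝ}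
    (hy : a ≤ y) : c * (y - a) * Q y ≤ 1 := by
  have hinv : Continuous fun y => -(Q y)⁻¹ := (hQc.inv₀ fun x => (hQ x).ne').neg
  have key := image_le_of_liminf_slope_right_le_deriv_boundary (f := fun y => -(Q y)⁻¹)
    (a := a) (b := y) (B := fun y => -(Q a)⁻¹ - c * (y - a)) (B' := fun _ => -c)
    hinv.continuousOn (by simp) (by fun_prop)
    (fun x _ => by
      have := (((hasDerivAt_id x).sub_const a).const_mul c).const_sub (-(Q a)⁻¹)
      simpa using this.hasDerivWithinAt)
    (fun x hx r hr => by
      have hlim : Tendsto (fun z => -c * (Q z / Q x)) (𝓝[>] x) (𝓝 (-c)) := by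
        have : ContinuousAt (fun z => -c * (Q z / Q x)) x := by fun_prop
        have h2 := this.tendsto
        rw [div_self (hQ x).ne', mul_one] at h2
        exact h2.mono_left nhdsWithin_le_nhds
      refine Eventually.frequently ?_
      filter_upwards [hlim.eventually_lt_const hr, self_mem_nhdsWithin] with z hz hxz
      refine lt_of_le_of_lt ?_ hz
      have hxz' : x < z := hxz
      have hQx := hQ x
      have hQz := hQ z
      rw [slope_def_field, div_le_iff₀ (by linarith)]
      have e : -(Q z)⁻¹ - -(Q x)⁻¹ = -((Q x - Q z) / (Q x * Q z)) := by field_simp; ring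
      have e2 : -c * (Q z / Q x) * (z - x) = -(c * (z - x) * Q z ^ 2 / (Q x * Q z)) := by
        field_simp
      rw [e, e2, neg_le_neg_iff]
      exact div_le_div_of_nonneg_right (h x z hx.1 hxz'.le) (by positivity))
  have hfin := key (Set.right_mem_Icc.2 hy)
  have hQy := hQ y
  have hQa : 0 < (Q a)⁻¹ := inv_pos.2 (hQ a)
  have : c * (y - a) ≤ (Q y)⁻¹ := by linarith
  calc c * (y - a) * Q y ≤ (Q y)⁻¹ * Q y := mul_le_mul_of_nonneg_right this hQy.le
    _ = 1 := inv_mul_cancel₀ hQy.ne'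

theorem integral_Ioi_sub_integral_Ioi {w : ℝ → ℝ} (hw : Integrable w) (x y : ℝ) :
    ∫ t in x..y, w t = (∫ t in Set.Ioi x, w t) - ∫ t in Set.Ioi y, w t := by
  rw [← intervalIntegral.integral_interval_add_Ioi hw.integrableOn (hw.integrableOn (s := .Ioi y)),
    add_sub_cancel_right]

theorem integral_Ioi_pos {w : ℝ → ℝ} (hw : Integrable w) (hpos : ∀ x, 0 < w x) (x : ℝ) :
    0 < ∫ t in Set.Ioi x, w t := by
  rw [setIntegral_pos_iff_support_of_nonneg_ae (.of_forall fun t => (hpos t).le) hw.integrableOn,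
    show Function.support w = Set.univ from Set.eq_univ_of_forall fun t => (hpos t).ne']
  simp

theorem integral_Iic_pos {w : ℝ → ℝ} (hw : Integrable w) (hpos : ∀ x, 0 < w x) (x : ℝ) :
    0 < ∫ t in Set.Iic x, w t := by
  have := integral_Ioi_pos hw.comp_neg (fun x => hpos (-x)) (-x)
  rwa [integral_comp_neg_Ioi, neg_neg] at this

/-- If `P² Q² ≤ δ w` on `[a, ∞)`, where `P` and `Q` are the two tails of `∫ w`, then
`Q(y) ≤ δ / (P(0)² (y - a))`. -/
theorem sq_mul_sub_mul_integral_Ioi_le {w : ℝ → ℝ} (hw : Integrable w) (hpos : ∀ x, 0 < w x)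
    {δ a : ℝ} (hδ : 0 < δ) (ha : 0 ≤ a)
    (h : ∀ s, a ≤ s → (∫ t in Set.Iic s, w t) ^ 2 * (∫ t in Set.Ioi s, w t) ^ 2 ≤ δ * w s)
    {y : ℝ} (hy : a ≤ y) :
    (∫ t in Set.Iic 0, w t) ^ 2 * (y - a) * ∫ t in Set.Ioi y, w t ≤ δ := by
  have hnn : ∀ s : Set ℝ, 0 ≤ᵐ[volume.restrict s] w := fun s => .of_forall fun t => (hpos t).le
  have hc : Continuous fun x => ∫ t in Set.Ioi x, w t := by
    have : (fun x => ∫ t in Set.Ioi x, w t) =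
        fun x => (∫ t in Set.Ioi (0 : ℝ), w t) - ∫ t in (0 : ℝ)..x, w t := by
      funext x
      rw [integral_Ioi_sub_integral_Ioi hw, sub_sub_cancel]
    rw [this]
    exact continuous_const.sub
      (intervalIntegral.continuous_primitive (fun a b => hw.intervalIntegrable) 0)
  have key := mul_sub_mul_le_one_of_riccati hc (integral_Ioi_pos hw hpos)
    (c := (∫ t in Set.Iic 0, w t) ^ 2 / δ) (a := a) (fun x y hx hxy => ?_) hy
  · rw [div_mul_eq_mul_div, div_mul_eq_mul_div, div_le_one hδ] at key
    exact key
  · rw [← integral_Ioi_sub_integral_Ioi hw]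
    have hconst : ∫ _ in x..y, (∫ t in Set.Iic 0, w t) ^ 2 / δ * (∫ t in Set.Ioi y, w t) ^ 2 =
        (∫ t in Set.Iic 0, w t) ^ 2 / δ * (y - x) * (∫ t in Set.Ioi y, w t) ^ 2 := by
      rw [intervalIntegral.integral_const, smul_eq_mul]; ring
    rw [← hconst]
    refine intervalIntegral.integral_mono_on hxy intervalIntegrable_const hw.intervalIntegrable
      fun s hs => ?_
    have h1 : ∫ t in Set.Iic 0, w t ≤ ∫ t in Set.Iic s, w t :=
      setIntegral_mono_set hw.integrableOn (hnn _)
        (Set.Iic_subset_Iic.2 (by linarith [hs.1])).eventuallyLE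
    have h2 : ∫ t in Set.Ioi y, w t ≤ ∫ t in Set.Ioi s, w t :=
      setIntegral_mono_set hw.integrableOn (hnn _) (Set.Ioi_subset_Ioi hs.2).eventuallyLE
    have h0 : 0 ≤ ∫ t in Set.Iic 0, w t := integral_nonneg_of_ae (hnn _)
    have h0' : 0 ≤ ∫ t in Set.Ioi y, w t := integral_nonneg_of_ae (hnn _)
    rw [div_mul_eq_mul_div, div_le_iff₀ hδ, mul_comm (w s)]
    exact (by gcongr : _ ≤ _).trans (h s (hx.trans hs.1))

/-- For a pair with Wronskian `v' u - u' v = w` and `u / v → 0` at `+∞`, the diagonal `u v` is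
bounded by the tail of `∫ w`. -/
theorem mul_le_integral_Ioi_of_wronskian {w u v u' v' : ℝ → ℝ} (hw : Integrable w)
    (hpos : ∀ x, 0 < w x) (hu : ∀ x, 0 < u x) (hv : ∀ x, 0 < v x) (hu' : ∀ x, u' x ≤ 0)
    (hv' : ∀ x, 0 ≤ v' x) (hu'i : ∀ a b, IntervalIntegrable u' volume a b)
    (hv'i : ∀ a b, IntervalIntegrable v' volume a b)
    (hud : ∀ a b, u b - u a = ∫ t in a..b, u' t) (hvd : ∀ a b, v b - v a = ∫ t in a..b, v' t)
    (hW : ∀ x, v' x * u x - u' x * v x = w x)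
    (hlim : Tendsto (fun x => u x / v x) atTop (𝓝 0)) (x : ℝ) :
    u x * v x ≤ ∫ t in Set.Ioi x, w t := by
  set Q := ∫ t in Set.Ioi x, w t
  have hQ0 : 0 < Q := integral_Ioi_pos hw hpos x
  have hvx := hv x
  have hwQ : ∀ y, ∫ t in x..y, w t ≤ Q := fun y => by
    rw [integral_Ioi_sub_integral_Ioi hw]
    linarith [integral_Ioi_pos hw hpos y]
  have hvmono : ∀ y, x ≤ y → v x ≤ v y := fun y hy => by
    have := intervalIntegral.integral_nonneg (μ := volume) hy fun t _ => hv' t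
    linarith [hvd x y]
  by_contra! hlt
  have hl : 0 < u x - Q / v x := by
    rw [sub_pos, div_lt_iff₀ hvx]; exact hlt
  set l := u x - Q / v x
  have hul : ∀ y, x ≤ y → l ≤ u y := fun y hy => by
    have h1 : ∫ t in x..y, -u' t ≤ ∫ t in x..y, w t / v x := by
      refine intervalIntegral.integral_mono_on hy (hu'i _ _).neg
        (hw.intervalIntegrable.div_const _) fun s hs => ?_
      rw [le_div_iff₀ hvx]
      nlinarith [hW s, mul_nonneg (hv' s) (hu s).le, hvmono s hs.1, hu' s]
    rw [intervalIntegral.integral_neg, ← hud, intervalIntegral.integral_div] at h1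
    have h2 := div_le_div_of_nonneg_right (hwQ y) hvx.le
    linarith
  have hvV : ∀ y, x ≤ y → v y ≤ v x + Q / l := fun y hy => by
    have h1 : ∫ t in x..y, v' t ≤ ∫ t in x..y, w t / l := by
      refine intervalIntegral.integral_mono_on hy (hv'i _ _)
        (hw.intervalIntegrable.div_const _) fun s hs => ?_
      rw [le_div_iff₀ hl]
      nlinarith [hW s, mul_nonneg (neg_nonneg.2 (hu' s)) (hv s).le, hul s hs.1, hv' s]
    rw [← hvd, intervalIntegral.integral_div] at h1
    have h2 := div_le_div_of_nonneg_right (hwQ y) hl.le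
    linarith
  have hV : 0 < l / (v x + Q / l) := by positivity
  refine absurd (ge_of_tendsto hlim ?_) (not_le.2 hV)
  filter_upwards [eventually_ge_atTop x] with y hy
  exact div_le_div₀ (hu y).le (hul y hy) (hv y) (hvV y hy)

/-- Reflected form of `mul_le_integral_Ioi_of_wronskian`. -/
theorem mul_le_integral_Iic_of_wronskian {w u v u' v' : ℝ → ℝ} (hw : Integrable w)
    (hpos : ∀ x, 0 < w x) (hu : ∀ x, 0 < u x) (hv : ∀ x, 0 < v x) (hu' : ∀ x, u' x ≤ 0)
    (hv' : ∀ x, 0 ≤ v' x) (hu'i : ∀ a b, IntervalIntegrable u' volume a b)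
    (hv'i : ∀ a b, IntervalIntegrable v' volume a b)
    (hud : ∀ a b, u b - u a = ∫ t in a..b, u' t) (hvd : ∀ a b, v b - v a = ∫ t in a..b, v' t)
    (hW : ∀ x, v' x * u x - u' x * v x = w x)
    (hlim : Tendsto (fun x => v x / u x) atBot (𝓝 0)) (x : ℝ) :
    u x * v x ≤ ∫ t in Set.Iic x, w t := by
  have hrefl : ∀ {g : ℝ → ℝ}, (∀ a b, IntervalIntegrable g volume a b) →
      ∀ a b, IntervalIntegrable (fun t => -g (-t)) volume a b := fun {g} hg a b => by
    have := (IntervalIntegrable.iff_comp_neg (f := g) (a := -a) (b := -b)).1 (hg _ _)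
    have h : IntervalIntegrable (fun t => g (-t)) volume a b := by simpa using this
    exact h.neg
  have hd : ∀ {g g' : ℝ → ℝ}, (∀ a b, g b - g a = ∫ t in a..b, g' t) →
      ∀ a b, g (-b) - g (-a) = ∫ t in a..b, -g' (-t) := fun {g g'} hg a b => by
    rw [intervalIntegral.integral_neg, intervalIntegral.integral_comp_neg, ← hg]; ring
  have := mul_le_integral_Ioi_of_wronskian (w := fun t => w (-t)) (u := fun t => v (-t))
    (v := fun t => u (-t)) (u' := fun t => -v' (-t)) (v' := fun t => -u' (-t)) hw.comp_neg
    (fun _ => hpos _) (fun _ => hv _) (fun _ => hu _) (fun _ => neg_nonpos.2 (hv' _))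
    (fun _ => neg_nonneg.2 (hu' _)) (hrefl hv'i) (hrefl hu'i) (hd hvd) (hd hud)
    (fun t => by rw [← hW]; ring) (hlim.comp tendsto_neg_atTop_atBot) (-x)
  rwa [integral_comp_neg_Ioi, neg_neg, mul_comm] at this

theorem greenKernel_eq (u v : ℝ → ℝ) (x t : ℝ) :
    greenKernel u v x t = u (max x t) * v (min x t) := by
  unfold greenKernel
  split_ifs with h
  · rw [max_eq_left h, min_eq_right h]
  · rw [max_eq_right (not_le.1 h).le, min_eq_left (not_le.1 h).le]

theorem continuous_greenKernel {u v : ℝ → ℝ} (hu : Continuous u) (hv : Continuous v) :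
    Continuous (Function.uncurry (greenKernel u v)) := by
  have : Function.uncurry (greenKernel u v) =
      fun z : ℝ × ℝ => u (max z.1 z.2) * v (min z.1 z.2) :=
    funext fun z => greenKernel_eq u v z.1 z.2
  rw [this]
  fun_prop

/-- If `u v` is dominated by a decreasing `Q` and an increasing `P`, then the Green kernel is
dominated by `max (P(-m)) (Q(m))` with `m = max(|x|, |t|)`. -/
theorem abs_greenKernel_le {u v P Q : ℝ → ℝ} (hu : ∀ x, 0 < u x) (hv : ∀ x, 0 < v x)
    (hua : Antitone u) (hvm : Monotone v) (hP : ∀ x, u x * v x ≤ P x)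
    (hQ : ∀ x, u x * v x ≤ Q x) (x t : ℝ) :
    |greenKernel u v x t| ≤ max (P (-max |x| |t|)) (Q (max |x| |t|)) := by
  rw [greenKernel_eq, abs_of_pos (mul_pos (hu _) (hv _))]
  have hle : min x t ≤ max x t := min_le_max
  have h1 : u (max x t) * v (min x t) ≤ P (min x t) :=
    (mul_le_mul_of_nonneg_right (hua hle) (hv _).le).trans (hP _)
  have h2 : u (max x t) * v (min x t) ≤ Q (max x t) :=
    (mul_le_mul_of_nonneg_left (hvm hle) (hu _).le).trans (hQ _)
  have hm : max |x| |t| = max x t ∨ -max |x| |t| = min x t := by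
    rcases abs_cases x with ⟨e1, _⟩ | ⟨e1, _⟩ <;> rcases abs_cases t with ⟨e2, _⟩ | ⟨e2, _⟩ <;>
      rw [e1, e2] <;> grind
  rcases hm with hm | hm
  · rw [hm]; exact h2.trans (le_max_right _ _)
  · rw [hm]; exact h1.trans (le_max_left _ _)

/-- If `P² Q² ≤ δ w` off `(-a, a)`, where `P` and `Q` are the two tails of `∫ w`, then both tails
at distance `y` from the origin are `O(δ / (y - a))`. -/
theorem sub_mul_max_integral_le {w : ℝ → ℝ} (hw : Integrable w) (hpos : ∀ x, 0 < w x)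
    {δ a : ℝ} (hδ : 0 < δ) (ha : 0 ≤ a)
    (h : ∀ s, a ≤ |s| → (∫ t in Set.Iic s, w t) ^ 2 * (∫ t in Set.Ioi s, w t) ^ 2 ≤ δ * w s)
    {y : ℝ} (hy : a ≤ y) :
    (y - a) * max (∫ t in Set.Iic (-y), w t) (∫ t in Set.Ioi y, w t) ≤
      δ / min (∫ t in Set.Iic 0, w t) (∫ t in Set.Ioi 0, w t) ^ 2 := by
  have hQ := integral_Ioi_pos hw hpos
  have hP := integral_Iic_pos hw hpos
  have hya : 0 ≤ y - a := sub_nonneg.2 hy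
  have hc : 0 < min (∫ t in Set.Iic 0, w t) (∫ t in Set.Ioi 0, w t) := lt_min (hP 0) (hQ 0)
  have h1 := sq_mul_sub_mul_integral_Ioi_le hw hpos hδ ha
    (fun s hs => h s (hs.trans (le_abs_self s))) hy
  have h2 := sq_mul_sub_mul_integral_Ioi_le hw.comp_neg (fun x => hpos (-x)) hδ ha
    (fun s hs => by
      rw [integral_comp_neg_Ioi, integral_comp_neg_Iic, mul_comm]
      exact h (-s) (by rw [abs_neg]; exact hs.trans (le_abs_self s))) hy
  rw [integral_comp_neg_Ioi, integral_comp_neg_Iic, neg_zero] at h2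
  rw [le_div_iff₀ (by positivity), mul_max_of_nonneg _ _ hya, max_mul_of_nonneg _ _ (sq_nonneg _)]
  refine max_le (le_trans ?_ h2) (le_trans ?_ h1)
  · rw [mul_comm, ← mul_assoc]
    have := (hP (-y)).le
    gcongr
    exact min_le_right _ _
  · rw [mul_comm, ← mul_assoc]
    have := (hQ y).le
    gcongr
    exact min_le_left _ _

/-- **Theorem 3.14.** Assume (1.2), (2.1) and `1/r ∈ L₁(ℝ)`, and let `u, v` be
a principal FSS.  With `ν(x) = r(x) (∫_{-∞}^x dt/r)² (∫_x^∞ dt/r)²`: if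
`sup ν < ∞` then for every `p ∈ (1,∞)` the Green operator is bounded on
`L_p(ℝ)`; if moreover `ν(x) → 0` as `|x| → ∞`, then it is compact. -/
theorem green_bounded_compact_of_nu
    (r q u v u' v' : ℝ → ℝ) (p : ℝ≥0∞) (hp1 : 1 < p) (hp2 : p ≠ ⊤)
    [Fact (1 ≤ p)]
    (h12 : Cond12 r q) (h21 : Cond21 q)
    (hrL1 : Integrable (fun t => 1 / r t) volume)
    (hfss : PFSS r q u v u' v')
    (ν : ℝ → ℝ)
    (hν : ∀ x : ℝ, ν x =
      r x * (∫ t in Set.Iic x, 1 / r t) ^ 2 * (∫ t in Set.Ici x, 1 / r t) ^ 2)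
    (hνbdd : BddAbove (Set.range ν)) :
    (∃ G : LpR p →L[ℝ] LpR p, IsGreenOp u v p G) ∧
      (Tendsto ν (cocompact ℝ) (𝓝 0) →
        ∃ G : LpR p →L[ℝ] LpR p, IsGreenOp u v p G ∧ IsCompactOperator G) := by
  obtain ⟨-, -, hr, -⟩ := h12
  have hpos : ∀ x, 0 < 1 / r x := fun x => one_div_pos.2 (hr x)
  have hW : ∀ x, v' x * u x - u' x * v x = 1 / r x := fun x => by
    rw [eq_div_iff (hr x).ne', mul_comm]
    exact hfss.wronskian x
  have hcont : ∀ {g g' : ℝ → ℝ}, (∀ a b, IntervalIntegrable g' volume a b) →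
      (∀ a b, g b - g a = ∫ t in a..b, g' t) → Continuous g := fun {g g'} hi hd => by
    have : g = fun x => g 0 + ∫ t in (0 : ℝ)..x, g' t := funext fun x => by rw [← hd]; ring
    rw [this]
    exact continuous_const.add (intervalIntegral.continuous_primitive hi 0)
  have hua : Antitone u := fun a b hab => by
    have := intervalIntegral.integral_nonneg (μ := volume) (f := fun t => -u' t) hab
      fun t _ => neg_nonneg.2 (hfss.u'_nonpos t)
    rw [intervalIntegral.integral_neg, ← hfss.u_deriv] at this
    linarith
  have hvm : Monotone v := fun a b hab => by
    have := intervalIntegral.integral_nonneg (μ := volume) hab fun t _ => hfss.v'_nonneg t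
    linarith [hfss.v_deriv a b]
  have hk := continuous_greenKernel (hcont hfss.u'_intble hfss.u_deriv)
    (hcont hfss.v'_intble hfss.v_deriv)
  have hG : ∀ x t, |greenKernel u v x t| ≤ max (∫ s in Set.Iic (-max |x| |t|), 1 / r s)
      (∫ s in Set.Ioi (max |x| |t|), 1 / r s) :=
    abs_greenKernel_le (P := fun x => ∫ s in Set.Iic x, 1 / r s)
      (Q := fun x => ∫ s in Set.Ioi x, 1 / r s) hfss.u_pos hfss.v_pos hua hvm
      (mul_le_integral_Iic_of_wronskian hrL1 hpos hfss.u_pos hfss.v_pos hfss.u'_nonpos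
        hfss.v'_nonneg hfss.u'_intble hfss.v'_intble hfss.u_deriv hfss.v_deriv hW hfss.ratio_bot)
      (mul_le_integral_Ioi_of_wronskian hrL1 hpos hfss.u_pos hfss.v_pos hfss.u'_nonpos
        hfss.v'_nonneg hfss.u'_intble hfss.v'_intble hfss.u_deriv hfss.v_deriv hW hfss.ratio_top)
  set c := min (∫ t in Set.Iic 0, 1 / r t) (∫ t in Set.Ioi 0, 1 / r t)
  have hkernel : ∀ {δ a : ℝ}, 0 < δ → 0 ≤ a → (∀ s, a ≤ |s| → ν s ≤ δ) → ∀ x t,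
      a ≤ max |x| |t| → (max |x| |t| - a) * |greenKernel u v x t| ≤ δ / c ^ 2 :=
    fun {δ a} hδ ha h x t hxt => by
      refine (mul_le_mul_of_nonneg_left (hG x t) (sub_nonneg.2 hxt)).trans
        (sub_mul_max_integral_le hrL1 hpos hδ ha (fun s hs => ?_) hxt)
      have := h s hs
      rw [hν, integral_Ici_eq_integral_Ioi, mul_assoc] at this
      rwa [mul_one_div, le_div_iff₀' (hr s)]
  obtain ⟨M, hM⟩ := hνbdd
  have hB : ∀ x t, max |x| |t| * |greenKernel u v x t| ≤
      ((max M 1 / c ^ 2).toNNReal : ℝ) := fun x t => by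
    refine le_trans ?_ (Real.le_coe_toNNReal _)
    simpa using hkernel (lt_max_of_lt_right one_pos) le_rfl
      (fun s _ => (hM (Set.mem_range_self s)).trans (le_max_left _ _)) x t
      ((abs_nonneg x).trans (le_max_left _ _))
  obtain ⟨C, hC⟩ := exists_clm_of_max_mul_abs_le hp1 hp2
  obtain ⟨G, hGop, -⟩ := hC (greenKernel u v) hk.measurable _ hB
  refine ⟨⟨G, hGop⟩, fun hlim => ⟨G, hGop, ?_⟩⟩
  refine isCompactOperator_of_max_mul_abs_tendsto hp1 hp2 hk hB (fun ε hε => ?_) hGop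
  have hc : 0 < c := lt_min (integral_Iic_pos hrL1 hpos 0) (integral_Ioi_pos hrL1 hpos 0)
  have hδ : 0 < ε * c ^ 2 / 2 := by positivity
  obtain ⟨a, ha⟩ : ∃ a : ℝ, ∀ s, a ≤ |s| → ν s ≤ ε * c ^ 2 / 2 := by
    have := hlim.eventually (eventually_le_nhds hδ)
    rw [← Metric.cobounded_eq_cocompact, ← comap_norm_atTop, eventually_comap,
      eventually_atTop] at this
    obtain ⟨a, ha⟩ := this
    exact ⟨a, fun s hs => ha _ hs s rfl⟩
  obtain ⟨N, hN⟩ := exists_nat_ge (2 * max a 0)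
  refine ⟨N, fun x t hxt => ?_⟩
  have ha0 : 0 ≤ max a 0 := le_max_right _ _
  have h := hkernel hδ ha0 (fun s hs => ha s ((le_max_left _ _).trans hs)) x t (by linarith)
  have h2 : ε * c ^ 2 / 2 / c ^ 2 = ε / 2 := by field_simp
  rw [h2] at h
  nlinarith [abs_nonneg (greenKernel u v x t)]
end
end

section
/- Assume conditions (1.2) and (1.3), let u, v be a principal fundamental system of solutions of (r z')' = q z, let p ∈ (1,∞) with p' = p/(p−1), and suppose B := sup_{x∈ℝ} h(x) d(x) < ∞. Define θ_p(x) = (∫_{-∞}^x v(t)^p dt)^{1/p} · (∫_x^∞ u(ξ)^{p'} dξ)^{1/p'}. Then there exists a constant c ≥ 1, depending only on p, such that for all x ∈ ℝ: c⁻¹ h(x) d(x) ≤ θ_p(x); θ_p(x) ≤ c · B^{1/p} · (sup_{t ≥ x} h(t) d(t))^{1/p'} whenever x ≥ 0; and θ_p(x) ≤ c · B^{1/p'} · (sup_{t ≤ x} h(t) d(t))^{1/p} whenever x ≤ 0. -/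
open MeasureTheory Filter Topology
open scoped ENNReal RealInnerProductSpace

noncomputable section

/-- `θ_p(x) = (∫_{-∞}^x v^p)^{1/p} (∫_x^∞ u^{p'})^{1/p'}` with `p' = p/(p-1)`. -/
def thetaP (u v : ℝ → ℝ) (p : ℝ) (x : ℝ) : ℝ :=
  (∫ t in Set.Iic x, v t ^ p) ^ (1 / p) *
    (∫ t in Set.Ici x, u t ^ (p / (p - 1))) ^ (1 / (p / (p - 1)))


/-- A function with an interval-integrable derivative is continuous. -/
theorem continuous_of_sub_eq_integral {f f' : ℝ → ℝ}
    (hint : ∀ a b : ℝ, IntervalIntegrable f' volume a b)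
    (hf : ∀ a b : ℝ, f b - f a = ∫ t in a..b, f' t) : Continuous f := by
  have h : f = fun x => f 0 + ∫ t in (0 : ℝ)..x, f' t := by
    funext x
    rw [← hf 0 x]
    ring
  rw [h]
  exact continuous_const.add (intervalIntegral.continuous_primitive hint 0)

theorem monotone_of_sub_eq_integral {f f' : ℝ → ℝ} (hnn : ∀ x, 0 ≤ f' x)
    (hf : ∀ a b : ℝ, f b - f a = ∫ t in a..b, f' t) : Monotone f := by
  intro a b hab
  have h := hf a b
  have h0 : 0 ≤ ∫ t in a..b, f' t := intervalIntegral.integral_nonneg hab fun t _ => hnn t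
  linarith

/-- Two-sided bound for the logarithmic quasi-derivative `r f' / f` of an increasing positive
solution of `(r f')' = q f` in terms of the averages of `1 / r` and `q`. -/
theorem logDeriv_bounds {r q f f' : ℝ → ℝ} (hr : ∀ x, 0 < r x)
    (hrint : ∀ a b : ℝ, IntervalIntegrable (fun t => 1 / r t) volume a b)
    (hq : ∀ x, 0 ≤ q x) (hqint : ∀ a b : ℝ, IntervalIntegrable q volume a b)
    (hfpos : ∀ x, 0 < f x) (hf'nn : ∀ x, 0 ≤ f' x)
    (hf'int : ∀ a b : ℝ, IntervalIntegrable f' volume a b)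
    (hf : ∀ a b : ℝ, f b - f a = ∫ t in a..b, f' t)
    (hrf' : ∀ a b : ℝ, r b * f' b - r a * f' a = ∫ t in a..b, q t * f t)
    {a x : ℝ} (hax : a ≤ x) (h1 : (∫ t in a..x, 1 / r t) * (∫ t in a..x, q t) = 1) :
    0 < (∫ t in a..x, 1 / r t) ∧ f x ≤ 2 * (∫ t in a..x, 1 / r t) * (r x * f' x) ∧
      (∫ t in a..x, 1 / r t) * (r x * f' x) ≤ 2 * f x := by
  have hcont := continuous_of_sub_eq_integral hf'int hf
  have hmono := monotone_of_sub_eq_integral hf'nn hf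
  have hqf : ∀ a b : ℝ, IntervalIntegrable (fun t => q t * f t) volume a b := fun a b =>
    (hqint a b).mul_continuousOn hcont.continuousOn
  have hmono' : Monotone fun t => r t * f' t :=
    monotone_of_sub_eq_integral (f' := fun t => q t * f t)
      (fun t => mul_nonneg (hq t) (hfpos t).le) hrf'
  have hφ0 : 0 ≤ ∫ t in a..x, 1 / r t :=
    intervalIntegral.integral_nonneg hax fun t _ => (one_div_pos.2 (hr t)).le
  set φ := ∫ t in a..x, 1 / r t with hφ
  set Q := ∫ t in a..x, q t with hQ
  have hφpos : 0 < φ := lt_of_le_of_ne hφ0 (by rintro h; rw [← h] at h1; simp at h1)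
  have hexp : ∀ t, f' t = (r t * f' t) * (1 / r t) := fun t => by
    have := (hr t).ne'
    field_simp
  have e1 : f x - f a ≤ (r x * f' x) * φ := by
    rw [hf a x, hφ, ← intervalIntegral.integral_const_mul]
    refine intervalIntegral.integral_mono_on hax (hf'int a x) ((hrint a x).const_mul _) ?_
    intro t ht
    rw [hexp t]
    exact mul_le_mul_of_nonneg_right (hmono' ht.2) (one_div_pos.2 (hr t)).le
  have e2 : f a * Q ≤ r x * f' x := by
    have h2 : f a * Q ≤ ∫ t in a..x, q t * f t := by
      rw [hQ, ← intervalIntegral.integral_const_mul]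
      refine intervalIntegral.integral_mono_on hax ((hqint a x).const_mul _) (hqf a x) ?_
      intro t ht
      rw [mul_comm]
      exact mul_le_mul_of_nonneg_left (hmono ht.1) (hq t)
    have h3 := hrf' a x
    have h4 := mul_nonneg (hr a).le (hf'nn a)
    linarith
  have e3 : ∀ t ∈ Set.Icc a x, r x * f' x - f x * Q ≤ r t * f' t := by
    intro t ht
    have h2 : ∫ s in t..x, q s * f s ≤ ∫ s in t..x, q s * f x := by
      refine intervalIntegral.integral_mono_on ht.2 (hqf t x) ((hqint t x).mul_const _) ?_
      intro s hs
      exact mul_le_mul_of_nonneg_left (hmono hs.2) (hq s)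
    rw [intervalIntegral.integral_mul_const] at h2
    have h3 : ∫ s in t..x, q s ≤ Q := by
      have h4 := intervalIntegral.integral_add_adjacent_intervals (hqint a t) (hqint t x)
      have h5 : 0 ≤ ∫ s in a..t, q s := intervalIntegral.integral_nonneg ht.1 fun s _ => hq s
      linarith
    have h6 := mul_le_mul_of_nonneg_right h3 (hfpos x).le
    have h7 := hrf' t x
    linarith
  have e4 : (r x * f' x - f x * Q) * φ ≤ f x - f a := by
    rw [hf a x, hφ, ← intervalIntegral.integral_const_mul]
    refine intervalIntegral.integral_mono_on hax ((hrint a x).const_mul _) (hf'int a x) ?_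
    intro t ht
    rw [hexp t]
    exact mul_le_mul_of_nonneg_right (e3 t ht) (one_div_pos.2 (hr t)).le
  refine ⟨hφpos, ?_, ?_⟩
  · have := mul_le_mul_of_nonneg_left e2 hφ0
    have h8 : φ * (f a * Q) = f a := by linear_combination f a * h1
    linarith
  · have h9 : (f x * Q) * φ = f x := by linear_combination f x * h1
    have := hfpos a
    linarith

/-- Growth of an increasing positive function is controlled by the integral of any majorant
of its logarithmic derivative. -/
theorem div_two_le_integral_of_two_pow_mul_le {f f' w : ℝ → ℝ} (hfpos : ∀ x, 0 < f x)
    (hf'nn : ∀ x, 0 ≤ f' x)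
    (hf'int : ∀ a b : ℝ, IntervalIntegrable f' volume a b)
    (hf : ∀ a b : ℝ, f b - f a = ∫ t in a..b, f' t)
    (hw : ∀ a b : ℝ, IntervalIntegrable w volume a b) (hfw : ∀ t, f' t ≤ f t * w t) (k : ℕ) :
    ∀ a b : ℝ, a ≤ b → 2 ^ k * f a ≤ f b → (k : ℝ) / 2 ≤ ∫ t in a..b, w t := by
  have hcont := continuous_of_sub_eq_integral hf'int hf
  have hmono := monotone_of_sub_eq_integral hf'nn hf
  have hwnn : ∀ t, 0 ≤ w t := fun t =>
    nonneg_of_mul_nonneg_right ((hf'nn t).trans (hfw t)) (hfpos t)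
  induction k with
  | zero =>
    intro a b hab _
    simpa using intervalIntegral.integral_nonneg hab fun t _ => hwnn t
  | succ k ih =>
    intro a b hab h
    have hk : (1 : ℝ) ≤ 2 ^ k := one_le_pow₀ (by norm_num)
    have hfa := hfpos a
    obtain ⟨c, hc, hfc⟩ : 2 ^ k * f a ∈ f '' Set.Icc a b := by
      refine intermediate_value_Icc hab hcont.continuousOn ⟨by nlinarith, ?_⟩
      rw [pow_succ] at h
      nlinarith
    have h1 := ih a c hc.1 hfc.ge
    have h2 : f b - f c ≤ f b * ∫ t in c..b, w t := by
      rw [hf c b, ← intervalIntegral.integral_const_mul]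
      refine intervalIntegral.integral_mono_on hc.2 (hf'int c b) ((hw c b).const_mul _) ?_
      intro t ht
      exact (hfw t).trans (mul_le_mul_of_nonneg_right (hmono ht.2) (hwnn t))
    have h3 : 2 * f c ≤ f b := by rw [hfc]; rw [pow_succ] at h; linarith
    have hfb := hfpos b
    have h4 : 1 / 2 ≤ ∫ t in c..b, w t := by
      by_contra hlt
      push Not at hlt
      nlinarith
    rw [← intervalIntegral.integral_add_adjacent_intervals (hw a c) (hw c b)]
    push_cast
    linarith

/-- If `v / u` grows by the factor `l`, then `v ^ (p - 1) / u` grows at least by the factor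
`l ^ min (p - 1) 1`. -/
theorem rpow_div_le_of_ratio_eq {p l ua ub va vb : ℝ} (hua : 0 < ua) (hub : 0 < ub)
    (hva : 0 < va) (hvb : 0 < vb) (hu : ub ≤ ua) (hv : va ≤ vb)
    (h : vb * ua = l * (va * ub)) :
    l ^ (min (p - 1) 1) * (va ^ (p - 1) / ua) ≤ vb ^ (p - 1) / ub := by
  have hl : l = (vb / va) * (ua / ub) := by field_simp; linarith
  have h1 : 1 ≤ vb / va := (one_le_div hva).2 hv
  have h2 : 1 ≤ ua / ub := (one_le_div hub).2 hu
  have h3 : l ^ (min (p - 1) 1) ≤ (vb / va) ^ (p - 1) * (ua / ub) := by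
    rw [hl, Real.mul_rpow (by positivity) (by positivity)]
    have h4 := Real.rpow_le_rpow_of_exponent_le h1 (min_le_left (p - 1) 1)
    have h5 := Real.rpow_le_rpow_of_exponent_le h2 (min_le_right (p - 1) 1)
    rw [Real.rpow_one] at h5
    exact mul_le_mul h4 h5 (by positivity) (by positivity)
  have hva' : 0 < va ^ (p - 1) := by positivity
  calc l ^ (min (p - 1) 1) * (va ^ (p - 1) / ua)
      ≤ ((vb / va) ^ (p - 1) * (ua / ub)) * (va ^ (p - 1) / ua) := by gcongr
    _ = vb ^ (p - 1) / ub := by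
        rw [Real.div_rpow hvb.le hva.le]
        field_simp

/-- The constant appearing in the one-sided integral estimates. -/
def tailConst (p : ℝ) : ℝ := (6 / 5) ^ p / (1 - ((6 / 5 : ℝ) ^ (min (p - 1) 1))⁻¹)

theorem one_lt_rpow_min {p : ℝ} (hp : 1 < p) : 1 < (6 / 5 : ℝ) ^ (min (p - 1) 1) :=
  Real.one_lt_rpow (by norm_num) (lt_min (by linarith) one_pos)

theorem tailConst_pos {p : ℝ} (hp : 1 < p) : 0 < tailConst p := by
  have h := inv_lt_one_of_one_lt₀ (one_lt_rpow_min hp)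
  have h2 : 0 < 1 - ((6 / 5 : ℝ) ^ (min (p - 1) 1))⁻¹ := by linarith
  unfold tailConst
  positivity

/-- Integral estimate for `v ^ p` over an interval on which `v / u` grows by the factor `6 / 5`. -/
theorem integral_rpow_le_of_ratio_eq {p M a b : ℝ} (hp : 1 < p) {u v : ℝ → ℝ}
    (hu : ∀ x, 0 < u x) (hv : ∀ x, 0 < v x) (hum : Antitone u) (hvm : Monotone v)
    (hvc : Continuous v) (hab : a ≤ b) (hR : v b * u a = 6 / 5 * (v a * u b))
    (hM : u ((a + b) / 2) * v ((a + b) / 2) * (b - a) ≤ M) :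
    ∫ t in a..b, v t ^ p ≤
      tailConst p * M * (v b ^ (p - 1) / u b - v a ^ (p - 1) / u a) := by
  have hg := rpow_div_le_of_ratio_eq (p := p) (hu a) (hu b) (hv a) (hv b) (hum hab) (hvm hab) hR
  have hl := one_lt_rpow_min hp
  have hlinv := inv_lt_one_of_one_lt₀ hl
  set L := (6 / 5 : ℝ) ^ (min (p - 1) 1) with hL
  set m := (a + b) / 2 with hm
  have ham : a ≤ m := by linarith
  have hmb : m ≤ b := by linarith
  have hua := hu a
  have hub := hu b
  have hva := hv a
  have hvb := hv b
  have hum' := hu m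
  have hvm' := hv m
  have hM0 : 0 ≤ M := le_trans (by have := sub_nonneg.2 hab; positivity) hM
  have hvba : v b ≤ 6 / 5 * v m := by
    have h1 : v b * u b ≤ v b * u a := mul_le_mul_of_nonneg_left (hum hab) (hv b).le
    have h2 : v b ≤ 6 / 5 * v a := by
      rw [hR] at h1
      refine le_of_mul_le_mul_right ?_ hub
      linarith
    linarith [hvm ham]
  have hcont : Continuous fun t => v t ^ p := hvc.rpow_const fun t => Or.inl (hv t).ne'
  have e1 : ∫ t in a..b, v t ^ p ≤ (b - a) * v b ^ p := by
    have : ∫ t in a..b, v t ^ p ≤ ∫ _ in a..b, v b ^ p := by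
      refine intervalIntegral.integral_mono_on hab (hcont.intervalIntegrable a b)
        intervalIntegrable_const ?_
      intro t ht
      exact Real.rpow_le_rpow (hv t).le (hvm ht.2) (by linarith)
    simpa using this
  have e2 : v b ^ p ≤ (6 / 5) ^ p * (v m * v m ^ (p - 1)) := by
    have h := Real.rpow_le_rpow (hv b).le hvba (by linarith : (0 : ℝ) ≤ p)
    rw [Real.mul_rpow (by norm_num) hvm'.le] at h
    have h3 : v m ^ p = v m * v m ^ (p - 1) := by
      rw [← Real.rpow_one_add' hvm'.le (by linarith)]
      ring_nf
    rwa [h3] at h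
  have e3 : v m ^ (p - 1) / u m ≤ v b ^ (p - 1) / u b := by
    have := Real.rpow_le_rpow hvm'.le (hvm hmb) (by linarith : 0 ≤ p - 1)
    exact div_le_div₀ (by positivity) this hub (hum hmb)
  have e4 : v a ^ (p - 1) / u a ≤ L⁻¹ * (v b ^ (p - 1) / u b) := by
    rw [le_inv_mul_iff₀ (by linarith)]
    exact hg
  have hpow : 0 < (6 / 5 : ℝ) ^ p := by positivity
  calc ∫ t in a..b, v t ^ p ≤ (b - a) * v b ^ p := e1
    _ ≤ (b - a) * ((6 / 5) ^ p * (v m * v m ^ (p - 1))) :=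
        mul_le_mul_of_nonneg_left e2 (sub_nonneg.2 hab)
    _ = (6 / 5) ^ p * ((u m * v m * (b - a)) * (v m ^ (p - 1) / u m)) := by
        field_simp
    _ ≤ (6 / 5) ^ p * (M * (v b ^ (p - 1) / u b)) := by gcongr
    _ = tailConst p * M * ((1 - L⁻¹) * (v b ^ (p - 1) / u b)) := by
        have : 1 - L⁻¹ ≠ 0 := by linarith
        unfold tailConst
        rw [← hL]
        generalize 1 - L⁻¹ = D at this
        field_simp
    _ ≤ tailConst p * M * (v b ^ (p - 1) / u b - v a ^ (p - 1) / u a) := by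
        have := tailConst_pos hp
        apply mul_le_mul_of_nonneg_left _ (by positivity)
        linarith

/-- Integrability and size of `v ^ p` on a left half-line. -/
theorem integral_Iic_rpow_le {p M x : ℝ} (hp : 1 < p) {u v : ℝ → ℝ}
    (hu : ∀ x, 0 < u x) (hv : ∀ x, 0 < v x) (hum : Antitone u) (hvm : Monotone v)
    (huc : Continuous u) (hvc : Continuous v) (hlim : Tendsto (fun x => v x / u x) atBot (𝓝 0))
    (hM0 : 0 ≤ M)
    (hM : ∀ a b, a ≤ b → b ≤ x → v b * u a ≤ 6 / 5 * (v a * u b) →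
      u ((a + b) / 2) * v ((a + b) / 2) * (b - a) ≤ M) :
    IntegrableOn (fun t => v t ^ p) (Set.Iic x) ∧
      ∫ t in Set.Iic x, v t ^ p ≤ tailConst p * M * (v x ^ (p - 1) / u x) := by
  have hRc : Continuous fun t => v t / u t := hvc.div huc fun t => (hu t).ne'
  have hRpos : ∀ t, 0 < v t / u t := fun t => div_pos (hv t) (hu t)
  have hRm : Monotone fun t => v t / u t := fun a b hab =>
    div_le_div₀ (hv b).le (hvm hab) (hu b) (hum hab)
  have hstep : ∀ b, ∃ a, a ≤ b ∧ v a / u a = (5 / 6) * (v b / u b) := by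
    intro b
    have hb := hRpos b
    obtain ⟨c, hc1, hc2⟩ := ((hlim.eventually_lt_const
      (by positivity : 0 < (5 / 6) * (v b / u b))).and (eventually_le_atBot b)).exists
    obtain ⟨a, ha, hae⟩ := intermediate_value_Icc hc2 hRc.continuousOn
      (show (5 / 6) * (v b / u b) ∈ _ from ⟨hc1.le, by linarith⟩)
    exact ⟨a, ha.2, hae⟩
  choose s hs1 hs2 using hstep
  let a : ℕ → ℝ := fun n => s^[n] x
  have ha0 : a 0 = x := rfl
  have hasucc : ∀ n, a (n + 1) = s (a n) := fun n => Function.iterate_succ_apply' s n x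
  have hax : ∀ n, a n ≤ x := by
    intro n
    induction n with
    | zero => exact le_rfl
    | succ n ih => rw [hasucc]; exact (hs1 _).trans ih
  have haR : ∀ n, v (a n) / u (a n) = (5 / 6) ^ n * (v x / u x) := by
    intro n
    induction n with
    | zero => simp [ha0]
    | succ n ih => rw [hasucc, hs2, ih]; ring
  have habot : Tendsto a atTop atBot := by
    rw [tendsto_atBot]
    intro t
    have h0 : Tendsto (fun n : ℕ => (5 / 6 : ℝ) ^ n * (v x / u x)) atTop (𝓝 0) := by
      simpa using (tendsto_pow_atTop_nhds_zero_of_lt_one (by norm_num : (0 : ℝ) ≤ 5 / 6)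
        (by norm_num)).mul_const (v x / u x)
    filter_upwards [h0.eventually_lt_const (hRpos t)] with n hn
    rw [← haR] at hn
    by_contra hlt
    exact absurd (hRm (not_le.1 hlt).le) (not_le.2 hn)
  have hcont : Continuous fun t => v t ^ p := hvc.rpow_const fun t => Or.inl (hv t).ne'
  have hK := (tailConst_pos hp).le
  have hbound : ∀ n, ∫ t in a n..x, v t ^ p ≤
      tailConst p * M * (v x ^ (p - 1) / u x - v (a n) ^ (p - 1) / u (a n)) := by
    intro n
    induction n with
    | zero => simp [ha0]
    | succ n ih =>
      have hle : a (n + 1) ≤ a n := by rw [hasucc]; exact hs1 _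
      have hR : v (a n) * u (a (n + 1)) = 6 / 5 * (v (a (n + 1)) * u (a n)) := by
        have h := hs2 (a n)
        rw [← hasucc] at h
        have h1 := (hu (a n)).ne'
        have h2 := (hu (a (n + 1))).ne'
        field_simp at h
        linarith
      have h := integral_rpow_le_of_ratio_eq hp hu hv hum hvm hvc hle hR
        (hM _ _ hle (hax n) hR.le)
      rw [← intervalIntegral.integral_add_adjacent_intervals
        (hcont.intervalIntegrable (a (n + 1)) (a n)) (hcont.intervalIntegrable (a n) x)]
      linarith
  have hbound' : ∀ n, ∫ t in a n..x, v t ^ p ≤ tailConst p * M * (v x ^ (p - 1) / u x) := by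
    intro n
    refine (hbound n).trans (mul_le_mul_of_nonneg_left ?_ (mul_nonneg hK hM0))
    have : 0 ≤ v (a n) ^ (p - 1) / u (a n) :=
      div_nonneg (Real.rpow_nonneg (hv _).le _) (hu _).le
    linarith
  have hint : IntegrableOn (fun t => v t ^ p) (Set.Iic x) := by
    refine integrableOn_Iic_of_intervalIntegral_norm_bounded
      (tailConst p * M * (v x ^ (p - 1) / u x)) x
      (fun n => (hcont.integrableOn_Icc (a := a n)).mono_set Set.Ioc_subset_Icc_self) habot
      (Eventually.of_forall fun n => ?_)
    simp_rw [Real.norm_of_nonneg (Real.rpow_nonneg (hv _).le p)]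
    exact hbound' n
  exact ⟨hint, le_of_tendsto (intervalIntegral_tendsto_integral_Iic x hint habot)
    (Eventually.of_forall hbound')⟩

/-- Integrability and size of `u ^ p` on a right half-line. -/
theorem integral_Ici_rpow_le {p M x : ℝ} (hp : 1 < p) {u v : ℝ → ℝ}
    (hu : ∀ x, 0 < u x) (hv : ∀ x, 0 < v x) (hum : Antitone u) (hvm : Monotone v)
    (huc : Continuous u) (hvc : Continuous v) (hlim : Tendsto (fun x => u x / v x) atTop (𝓝 0))
    (hM0 : 0 ≤ M)
    (hM : ∀ a b, a ≤ b → x ≤ a → v b * u a ≤ 6 / 5 * (v a * u b) →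
      u ((a + b) / 2) * v ((a + b) / 2) * (b - a) ≤ M) :
    IntegrableOn (fun t => u t ^ p) (Set.Ici x) ∧
      ∫ t in Set.Ici x, u t ^ p ≤ tailConst p * M * (u x ^ (p - 1) / v x) := by
  have key := integral_Iic_rpow_le (p := p) (M := M) (x := -x) hp (u := fun t => v (-t))
    (v := fun t => u (-t)) (fun t => hv _) (fun t => hu _)
    (fun a b hab => hvm (neg_le_neg hab)) (fun a b hab => hum (neg_le_neg hab))
    (hvc.comp continuous_neg) (huc.comp continuous_neg) (hlim.comp tendsto_neg_atBot_atTop) hM0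
    (by
      intro a b hab hb h
      have h2 := hM (-b) (-a) (neg_le_neg hab) (by linarith) (by linarith)
      have h3 : (-b + -a) / 2 = -((a + b) / 2) := by ring
      rw [h3] at h2
      linarith)
  simp only [neg_neg] at key
  refine ⟨?_, ?_⟩
  · have := key.1.comp_neg_Ici
    simpa using this
  · have := integral_comp_neg_Iic (-x) (fun t => u t ^ p)
    rw [neg_neg] at this
    rw [integral_Ici_eq_integral_Ioi, ← this]
    exact key.2

theorem Cond12.inv_intervalIntegrable {r q : ℝ → ℝ} (h : Cond12 r q) (a b : ℝ) :
    IntervalIntegrable (fun t => 1 / r t) volume a b :=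
  (h.2.2.2.2.1.integrableOn_isCompact isCompact_uIcc).intervalIntegrable

theorem Cond12.intervalIntegrable {r q : ℝ → ℝ} (h : Cond12 r q) (a b : ℝ) :
    IntervalIntegrable q volume a b :=
  (h.2.2.2.2.2.integrableOn_isCompact isCompact_uIcc).intervalIntegrable

section PFSS

variable {r q u v u' v' d₁ d₂ d : ℝ → ℝ}

theorem PFSS.v_continuous (hP : PFSS r q u v u' v') : Continuous v :=
  continuous_of_sub_eq_integral hP.v'_intble hP.v_deriv

theorem PFSS.u_continuous (hP : PFSS r q u v u' v') : Continuous u :=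
  continuous_of_sub_eq_integral hP.u'_intble hP.u_deriv

theorem PFSS.v_monotone (hP : PFSS r q u v u' v') : Monotone v :=
  monotone_of_sub_eq_integral hP.v'_nonneg hP.v_deriv

theorem PFSS.reflect_deriv (hP : PFSS r q u v u' v') (a b : ℝ) :
    u (-b) - u (-a) = ∫ t in a..b, -u' (-t) := by
  rw [intervalIntegral.integral_neg, intervalIntegral.integral_comp_neg, ← hP.u_deriv]
  ring

theorem PFSS.reflect_intble (hP : PFSS r q u v u' v') (a b : ℝ) :
    IntervalIntegrable (fun t => -u' (-t)) volume a b := by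
  have h := (IntervalIntegrable.iff_comp_neg (by finiteness)).1 (hP.u'_intble (-a) (-b))
  rw [neg_neg, neg_neg] at h
  exact h.neg

theorem PFSS.u_antitone (hP : PFSS r q u v u' v') : Antitone u := by
  intro a b hab
  have h := monotone_of_sub_eq_integral (f := fun t => u (-t)) (f' := fun t => -u' (-t))
    (fun t => neg_nonneg.2 (hP.u'_nonpos _)) hP.reflect_deriv (neg_le_neg hab)
  simpa using h

/-- `h` and `u v` are equivalent up to the factor `2`. -/
theorem PFSS.hF_bounds (hP : PFSS r q u v u' v') (h12 : Cond12 r q) (h1 : IsD1 r q d₁)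
    (h2 : IsD2 r q d₂) (x : ℝ) :
    0 < hF r d₁ d₂ x ∧ hF r d₁ d₂ x ≤ 2 * (u x * v x) ∧ u x * v x ≤ 2 * hF r d₁ d₂ x := by
  obtain ⟨hφ, hv1, hv2⟩ := logDeriv_bounds h12.2.2.1 h12.inv_intervalIntegrable h12.2.2.2.1
    h12.intervalIntegrable hP.v_pos hP.v'_nonneg hP.v'_intble hP.v_deriv hP.rv'_deriv
    (by linarith [(h1 x).1] : x - d₁ x ≤ x) (h1 x).2
  have hI : ∀ (f : ℝ → ℝ), (∀ a b, IntervalIntegrable f volume a b) →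
      ∀ a b, IntervalIntegrable (fun t => f (-t)) volume a b := by
    intro f hf a b
    simpa using (IntervalIntegrable.iff_comp_neg (by finiteness)).1 (hf (-a) (-b))
  have e : ∀ f : ℝ → ℝ, ∫ t in -(x + d₂ x)..-x, f (-t) = ∫ t in x..x + d₂ x, f t := by
    intro f
    rw [intervalIntegral.integral_comp_neg, neg_neg, neg_neg]
  have hu := logDeriv_bounds (r := fun t => r (-t)) (q := fun t => q (-t)) (f := fun t => u (-t))
    (f' := fun t => -u' (-t)) (fun t => h12.2.2.1 _) (hI _ h12.inv_intervalIntegrable)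
    (fun t => h12.2.2.2.1 _) (hI _ h12.intervalIntegrable) (fun t => hP.u_pos _)
    (fun t => neg_nonneg.2 (hP.u'_nonpos _)) hP.reflect_intble hP.reflect_deriv
    (fun a b => by
      rw [intervalIntegral.integral_comp_neg (fun t => q t * u t), ← hP.ru'_deriv]
      ring)
    (by linarith [(h2 x).1] : -(x + d₂ x) ≤ -x)
    (by rw [e (fun t => 1 / r t), e q]; exact (h2 x).2)
  rw [e (fun t => 1 / r t)] at hu
  simp only [neg_neg] at hu
  obtain ⟨hψ, hu1, hu2⟩ := hu
  have hW := hP.wronskian x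
  have hux := hP.u_pos x
  have hvx := hP.v_pos x
  unfold hF phiF psiF
  set φ := ∫ t in x - d₁ x..x, 1 / r t
  set ψ := ∫ t in x..x + d₂ x, 1 / r t
  have hφψ : φ * ψ = φ * ψ * (r x * (v' x * u x - u' x * v x)) := by rw [hW, mul_one]
  refine ⟨by positivity, ?_, ?_⟩
  · rw [div_le_iff₀ (by positivity)]
    have m1 := mul_le_mul_of_nonneg_left hv2 (mul_pos hψ hux).le
    have m2 := mul_le_mul_of_nonneg_left hu2 (mul_pos hφ hvx).le
    linarith
  · rw [← mul_div_assoc, le_div_iff₀ (by positivity)]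
    have m1 := mul_le_mul_of_nonneg_left hv1 (mul_pos hψ hux).le
    have m2 := mul_le_mul_of_nonneg_left hu1 (mul_pos hφ hvx).le
    linarith

theorem PFSS.weight_intble (hP : PFSS r q u v u' v') (h12 : Cond12 r q) (a b : ℝ) :
    IntervalIntegrable (fun t => 1 / (r t * (u t * v t))) volume a b := by
  have hc : Continuous fun t => 1 / (u t * v t) :=
    continuous_const.div (hP.u_continuous.mul hP.v_continuous)
      fun t => (mul_pos (hP.u_pos t) (hP.v_pos t)).ne'
  have := (h12.inv_intervalIntegrable a b).mul_continuousOn hc.continuousOn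
  refine this.congr (fun t _ => ?_)
  simp only [one_div, mul_inv]

theorem PFSS.weight_eq (hP : PFSS r q u v u' v') (h12 : Cond12 r q) (t : ℝ) :
    1 / (r t * (u t * v t)) = v' t / v t + -u' t / u t := by
  have hr := (h12.2.2.1 t).ne'
  have hu := (hP.u_pos t).ne'
  have hv := (hP.v_pos t).ne'
  have hW := hP.wronskian t
  field_simp
  linarith

theorem PFSS.v'_le (hP : PFSS r q u v u' v') (h12 : Cond12 r q) (t : ℝ) :
    v' t ≤ v t * (1 / (r t * (u t * v t))) := by
  have hu := hP.u_pos t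
  have hv := hP.v_pos t
  have h := hP.u'_nonpos t
  rw [hP.weight_eq h12, mul_add, mul_div_cancel₀ _ hv.ne']
  have : 0 ≤ v t * (-u' t / u t) := by have := neg_nonneg.2 h; positivity
  linarith

theorem PFSS.neg_u'_le (hP : PFSS r q u v u' v') (h12 : Cond12 r q) (t : ℝ) :
    -u' t ≤ u t * (1 / (r t * (u t * v t))) := by
  have hu := hP.u_pos t
  have hv := hP.v_pos t
  have h := hP.v'_nonneg t
  rw [hP.weight_eq h12, mul_add, mul_div_cancel₀ _ hu.ne']
  have : 0 ≤ u t * (v' t / v t) := by positivity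
  linarith

/-- The integral of `1 / (r u v)` over `[x - d, x + d]` lies between `1 / 2` and `2`. -/
theorem PFSS.integral_weight_bounds (hP : PFSS r q u v u' v') (h12 : Cond12 r q)
    (h1 : IsD1 r q d₁) (h2 : IsD2 r q d₂) (hd : IsD r (hF r d₁ d₂) d) (x : ℝ) :
    1 / 2 ≤ (∫ t in x - d x..x + d x, 1 / (r t * (u t * v t))) ∧
      (∫ t in x - d x..x + d x, 1 / (r t * (u t * v t))) ≤ 2 := by
  obtain ⟨hd0, hd1⟩ := hd x
  have hle : x - d x ≤ x + d x := by linarith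
  have hint : IntervalIntegrable (fun t => 1 / (r t * hF r d₁ d₂ t)) volume
      (x - d x) (x + d x) := by
    by_contra h
    rw [intervalIntegral.integral_undef h] at hd1
    exact zero_ne_one hd1
  have hw := hP.weight_intble h12 (x - d x) (x + d x)
  have hb := hP.hF_bounds h12 h1 h2
  have b1 : ∀ t, 1 / (r t * hF r d₁ d₂ t) ≤ 2 * (1 / (r t * (u t * v t))) := by
    intro t
    obtain ⟨h0, -, h4⟩ := hb t
    have hr := h12.2.2.1 t
    have hρ := mul_pos (hP.u_pos t) (hP.v_pos t)
    rw [mul_one_div, div_le_div_iff₀ (by positivity) (by positivity)]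
    have := mul_le_mul_of_nonneg_left h4 hr.le
    linarith
  have b2 : ∀ t, 1 / (r t * (u t * v t)) ≤ 2 * (1 / (r t * hF r d₁ d₂ t)) := by
    intro t
    obtain ⟨h0, h3, -⟩ := hb t
    have hr := h12.2.2.1 t
    have hρ := mul_pos (hP.u_pos t) (hP.v_pos t)
    rw [mul_one_div, div_le_div_iff₀ (by positivity) (by positivity)]
    have := mul_le_mul_of_nonneg_left h3 hr.le
    linarith
  have i1 := intervalIntegral.integral_mono_on hle hint (hw.const_mul 2) fun t _ => b1 t
  have i2 := intervalIntegral.integral_mono_on hle hw (hint.const_mul 2) fun t _ => b2 t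
  rw [intervalIntegral.integral_const_mul] at i1 i2
  constructor <;> linarith

/-- On an interval where `v / u` grows at most by the factor `6 / 5`, the length is controlled
by `d` at the midpoint. -/
theorem PFSS.mul_length_le (hP : PFSS r q u v u' v') (h12 : Cond12 r q)
    (h1 : IsD1 r q d₁) (h2 : IsD2 r q d₂) (hd : IsD r (hF r d₁ d₂) d) {a b : ℝ} (hab : a ≤ b)
    (hR : v b * u a ≤ 6 / 5 * (v a * u b)) :
    u ((a + b) / 2) * v ((a + b) / 2) * (b - a) ≤
      4 * (hF r d₁ d₂ ((a + b) / 2) * d ((a + b) / 2)) := by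
  set m := (a + b) / 2 with hm
  obtain ⟨hd0, -⟩ := hd m
  obtain ⟨hh0, -, hρ⟩ := hP.hF_bounds h12 h1 h2 m
  have hlen : b - a ≤ 2 * d m := by
    by_contra hlt
    push Not at hlt
    have ha : a ≤ m - d m := by linarith
    have hb : m + d m ≤ b := by linarith
    have hle : m - d m ≤ m + d m := by linarith
    have hva := hP.v_pos a
    have hub := hP.u_pos b
    have hv : v b ≤ 6 / 5 * v a := by
      have h3 := mul_le_mul_of_nonneg_left (hP.u_antitone hab) (hP.v_pos b).le
      refine le_of_mul_le_mul_right ?_ hub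
      linarith
    have hu : u a ≤ 6 / 5 * u b := by
      have h3 := mul_le_mul_of_nonneg_right (hP.v_monotone hab) (hP.u_pos a).le
      refine le_of_mul_le_mul_left ?_ hva
      linarith
    have hi := (hP.integral_weight_bounds h12 h1 h2 hd m).1
    have hv'i := hP.v'_intble (m - d m) (m + d m)
    have hu'i : IntervalIntegrable (fun t => -u' t) volume (m - d m) (m + d m) :=
      (hP.u'_intble (m - d m) (m + d m)).neg
    have hmono : ∫ t in m - d m..m + d m, 1 / (r t * (u t * v t)) ≤
        ∫ t in m - d m..m + d m, (v' t / v a + -u' t / u b) := by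
      refine intervalIntegral.integral_mono_on hle (hP.weight_intble h12 _ _)
        ((hv'i.div_const _).add (hu'i.div_const _)) ?_
      intro t ht
      rw [hP.weight_eq h12]
      have e1 := hP.v_monotone (ha.trans ht.1)
      have e2 := hP.u_antitone (ht.2.trans hb)
      have e3 := hP.v'_nonneg t
      have e4 := neg_nonneg.2 (hP.u'_nonpos t)
      gcongr
    rw [intervalIntegral.integral_add (hv'i.div_const _) (hu'i.div_const _),
      intervalIntegral.integral_div, intervalIntegral.integral_div,
      intervalIntegral.integral_neg, ← hP.v_deriv, ← hP.u_deriv] at hmono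
    have f1 : (v (m + d m) - v (m - d m)) / v a ≤ 1 / 5 := by
      rw [div_le_iff₀ hva]
      linarith [hP.v_monotone ha, hP.v_monotone hb]
    have f2 : -(u (m + d m) - u (m - d m)) / u b ≤ 1 / 5 := by
      rw [div_le_iff₀ hub]
      linarith [hP.u_antitone ha, hP.u_antitone hb]
    linarith
  calc u m * v m * (b - a) ≤ (2 * hF r d₁ d₂ m) * (2 * d m) :=
        mul_le_mul hρ hlen (sub_nonneg.2 hab) (by positivity)
    _ = 4 * (hF r d₁ d₂ m * d m) := by ring

/-- `v` decreases at most by the factor `32` from `x` to `x - d x`. -/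
theorem PFSS.v_le (hP : PFSS r q u v u' v') (h12 : Cond12 r q)
    (h1 : IsD1 r q d₁) (h2 : IsD2 r q d₂) (hd : IsD r (hF r d₁ d₂) d) (x : ℝ) :
    v x ≤ 32 * v (x - d x) := by
  by_contra hlt
  push Not at hlt
  have hd0 := (hd x).1
  have h := div_two_le_integral_of_two_pow_mul_le hP.v_pos hP.v'_nonneg hP.v'_intble hP.v_deriv
    (hP.weight_intble h12) (hP.v'_le h12) 5 (x - d x) x (by linarith) (by linarith)
  have hi := (hP.integral_weight_bounds h12 h1 h2 hd x).2
  have h3 : 0 ≤ ∫ t in x..x + d x, 1 / (r t * (u t * v t)) :=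
    intervalIntegral.integral_nonneg (by linarith) fun t _ => one_div_nonneg.2
      (mul_pos (h12.2.2.1 t) (mul_pos (hP.u_pos t) (hP.v_pos t))).le
  rw [← intervalIntegral.integral_add_adjacent_intervals (hP.weight_intble h12 _ x)
    (hP.weight_intble h12 x _)] at hi
  norm_num at h
  norm_num at hi h3
  linarith

/-- `u` decreases at most by the factor `32` from `x` to `x + d x`. -/
theorem PFSS.u_le (hP : PFSS r q u v u' v') (h12 : Cond12 r q)
    (h1 : IsD1 r q d₁) (h2 : IsD2 r q d₂) (hd : IsD r (hF r d₁ d₂) d) (x : ℝ) :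
    u x ≤ 32 * u (x + d x) := by
  by_contra hlt
  push Not at hlt
  have hd0 := (hd x).1
  have h := div_two_le_integral_of_two_pow_mul_le (f := fun t => u (-t))
    (f' := fun t => -u' (-t)) (w := fun t => 1 / (r (-t) * (u (-t) * v (-t))))
    (fun t => hP.u_pos _) (fun t => neg_nonneg.2 (hP.u'_nonpos _)) hP.reflect_intble
    hP.reflect_deriv
    (fun a b => by
      simpa using (IntervalIntegrable.iff_comp_neg (by finiteness)).1
        (hP.weight_intble h12 (-a) (-b)))
    (fun t => hP.neg_u'_le h12 (-t)) 5 (-(x + d x)) (-x) (by linarith)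
    (by simp only [neg_neg]; linarith)
  rw [intervalIntegral.integral_comp_neg (fun t => 1 / (r t * (u t * v t))), neg_neg,
    neg_neg] at h
  have hi := (hP.integral_weight_bounds h12 h1 h2 hd x).2
  have h3 : 0 ≤ ∫ t in x - d x..x, 1 / (r t * (u t * v t)) :=
    intervalIntegral.integral_nonneg (by linarith) fun t _ => one_div_nonneg.2
      (mul_pos (h12.2.2.1 t) (mul_pos (hP.u_pos t) (hP.v_pos t))).le
  rw [← intervalIntegral.integral_add_adjacent_intervals (hP.weight_intble h12 _ x)
    (hP.weight_intble h12 x _)] at hi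
  norm_num at h
  norm_num at hi h3
  linarith

end PFSS

/-- Upper bound for a product of conjugate powers of the one-sided tail estimates. -/
theorem conj_rpow_mul_le {p p' I J K K' M N u v : ℝ} (hpp : p.HolderConjugate p')
    (hI : 0 ≤ I) (hJ : 0 ≤ J) (hK : 0 ≤ K) (hK' : 0 ≤ K') (hM : 0 ≤ M) (hN : 0 ≤ N)
    (hu : 0 < u) (hv : 0 < v)
    (h1 : I ≤ K * (4 * M) * (v ^ (p - 1) / u)) (h2 : J ≤ K' * (4 * N) * (u ^ (p' - 1) / v)) :
    I ^ (1 / p) * J ^ (1 / p') ≤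
      4 * K ^ (1 / p) * K' ^ (1 / p') * M ^ (1 / p) * N ^ (1 / p') := by
  have hp := hpp.pos
  have hp' := hpp.symm.pos
  have hs : 1 / p + 1 / p' = 1 := by simpa using hpp.inv_add_inv_eq_one
  have e1 : (p - 1) * (1 / p) = 1 / p' := by
    have : (p - 1) * (1 / p) = 1 - 1 / p := by field_simp
    linarith
  have e2 : (p' - 1) * (1 / p') = 1 / p := by
    have : (p' - 1) * (1 / p') = 1 - 1 / p' := by field_simp
    linarith
  have g1 := Real.rpow_le_rpow hI h1 (one_div_nonneg.2 hp.le)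
  have g2 := Real.rpow_le_rpow hJ h2 (one_div_nonneg.2 hp'.le)
  refine (mul_le_mul g1 g2 (by positivity) (by positivity)).trans_eq ?_
  rw [Real.mul_rpow (by positivity) (by positivity), Real.mul_rpow hK (by positivity),
    Real.mul_rpow (by norm_num) hM, Real.div_rpow (by positivity) hu.le, ← Real.rpow_mul hv.le,
    Real.mul_rpow (by positivity) (by positivity), Real.mul_rpow hK' (by positivity),
    Real.mul_rpow (by norm_num) hN, Real.div_rpow (by positivity) hv.le, ← Real.rpow_mul hu.le,
    e1, e2]
  have h4 : (4 : ℝ) ^ (1 / p) * 4 ^ (1 / p') = 4 := by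
    rw [← Real.rpow_add (by norm_num), hs, Real.rpow_one]
  have hvp : v ^ (1 / p') ≠ 0 := by positivity
  have hup : u ^ (1 / p) ≠ 0 := by positivity
  field_simp
  linear_combination (K ^ (1 / p) * M ^ (1 / p) * K' ^ (1 / p') * N ^ (1 / p')) * h4

/-- Lower bound for a product of conjugate powers. -/
theorem le_conj_rpow_mul {p p' I J D U V : ℝ} (hpp : p.HolderConjugate p')
    (hD : 0 ≤ D) (hU : 0 ≤ U) (hV : 0 ≤ V) (h1 : D * V ^ p ≤ I) (h2 : D * U ^ p' ≤ J) :
    D * (U * V) ≤ I ^ (1 / p) * J ^ (1 / p') := by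
  have hp := hpp.pos
  have hp' := hpp.symm.pos
  have hs : 1 / p + 1 / p' = 1 := by simpa using hpp.inv_add_inv_eq_one
  have g1 := Real.rpow_le_rpow (by positivity) h1 (one_div_nonneg.2 hp.le)
  have g2 := Real.rpow_le_rpow (by positivity) h2 (one_div_nonneg.2 hp'.le)
  refine le_trans (le_of_eq ?_) (mul_le_mul g1 g2 (by positivity)
    (Real.rpow_nonneg (le_trans (by positivity) h1) _))
  rw [Real.mul_rpow hD (by positivity), Real.mul_rpow hD (by positivity), ← Real.rpow_mul hV,
    ← Real.rpow_mul hU, mul_one_div_cancel hp.ne', mul_one_div_cancel hp'.ne', Real.rpow_one,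
    Real.rpow_one]
  have h4 : D ^ (1 / p) * D ^ (1 / p') = D := by
    rw [← Real.rpow_add' hD (by rw [hs]; norm_num), hs, Real.rpow_one]
  linear_combination (-(U * V)) * h4

/-- A nonnegative function's integral dominates its lower bound on an interval. -/
theorem length_mul_le_setIntegral {f : ℝ → ℝ} {s : Set ℝ} {a b c : ℝ}
    (hf : IntegrableOn f s) (hf0 : ∀ t, 0 ≤ f t) (hab : a ≤ b) (hsub : Set.Icc a b ⊆ s)
    (hc : ∀ t ∈ Set.Icc a b, c ≤ f t) : (b - a) * c ≤ ∫ t in s, f t := by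
  calc (b - a) * c = ∫ _ in Set.Icc a b, c := by simp [hab]
    _ ≤ ∫ t in Set.Icc a b, f t :=
        setIntegral_mono_on (by simp) (hf.mono_set hsub) measurableSet_Icc hc
    _ ≤ ∫ t in s, f t :=
        setIntegral_mono_set hf (Eventually.of_forall hf0) hsub.eventuallyLE

/-- **Lemma 4.2.** Let `p ∈ (1,∞)`, `p' = p/(p-1)`.  There is `c ≥ 1`
(depending only on `p`) such that whenever (1.2), (1.3) hold, `u, v` is a
principal FSS and `B = sup_x h(x)d(x) < ∞`, one has for all `x`:
`c⁻¹ h(x)d(x) ≤ θ_p(x)`; `θ_p(x) ≤ c B^{1/p} (sup_{t ≥ x} h(t)d(t))^{1/p'}`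
for `x ≥ 0`; and `θ_p(x) ≤ c B^{1/p'} (sup_{t ≤ x} h(t)d(t))^{1/p}` for
`x ≤ 0`. -/
theorem thetaP_two_sided_estimate (p : ℝ) (hp : 1 < p) :
    ∃ c : ℝ, 1 ≤ c ∧
      ∀ (r q u v u' v' d₁ d₂ d : ℝ → ℝ),
        Cond12 r q → Cond13 r q → PFSS r q u v u' v' →
        IsD1 r q d₁ → IsD2 r q d₂ → IsD r (hF r d₁ d₂) d →
        BddAbove (Set.range fun x => hF r d₁ d₂ x * d x) →
        ∀ x : ℝ,
          c⁻¹ * (hF r d₁ d₂ x * d x) ≤ thetaP u v p x ∧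
          (0 ≤ x → thetaP u v p x ≤
            c * (⨆ y : ℝ, hF r d₁ d₂ y * d y) ^ (1 / p) *
              (⨆ t : Set.Ici x, hF r d₁ d₂ ↑t * d ↑t) ^ (1 / (p / (p - 1)))) ∧
          (x ≤ 0 → thetaP u v p x ≤
            c * (⨆ y : ℝ, hF r d₁ d₂ y * d y) ^ (1 / (p / (p - 1))) *
              (⨆ t : Set.Iic x, hF r d₁ d₂ ↑t * d ↑t) ^ (1 / p)) := by
  have hpp : p.HolderConjugate (p / (p - 1)) := by
    simpa [Real.conjExponent] using Real.HolderConjugate.conjExponent hp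
  have hp' : 1 < p / (p - 1) := hpp.symm.lt
  set p' := p / (p - 1) with hp'def
  refine ⟨max 2048 (4 * tailConst p ^ (1 / p) * tailConst p' ^ (1 / p')),
    le_trans (by norm_num) (le_max_left _ _), ?_⟩
  intro r q u v u' v' d₁ d₂ d h12 _ hP h1 h2 hd hB x
  set C := max 2048 (4 * tailConst p ^ (1 / p) * tailConst p' ^ (1 / p'))
  have hK := (tailConst_pos hp).le
  have hK' := (tailConst_pos hp').le
  have hu := hP.u_pos
  have hv := hP.v_pos
  have hhd : ∀ y, 0 < hF r d₁ d₂ y * d y := fun y =>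
    mul_pos (hP.hF_bounds h12 h1 h2 y).1 (hd y).1
  have hleft : ∀ M, 0 ≤ M → (∀ y, y ≤ x → hF r d₁ d₂ y * d y ≤ M) →
      IntegrableOn (fun t => v t ^ p) (Set.Iic x) ∧
        ∫ t in Set.Iic x, v t ^ p ≤ tailConst p * (4 * M) * (v x ^ (p - 1) / u x) := by
    intro M hM0 hM
    refine integral_Iic_rpow_le hp hu hv hP.u_antitone hP.v_monotone hP.u_continuous
      hP.v_continuous hP.ratio_bot (by positivity) fun a b hab hb hR => ?_
    have := hM ((a + b) / 2) (by linarith)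
    linarith [hP.mul_length_le h12 h1 h2 hd hab hR]
  have hright : ∀ M, 0 ≤ M → (∀ y, x ≤ y → hF r d₁ d₂ y * d y ≤ M) →
      IntegrableOn (fun t => u t ^ p') (Set.Ici x) ∧
        ∫ t in Set.Ici x, u t ^ p' ≤ tailConst p' * (4 * M) * (u x ^ (p' - 1) / v x) := by
    intro M hM0 hM
    refine integral_Ici_rpow_le hp' hu hv hP.u_antitone hP.v_monotone hP.u_continuous
      hP.v_continuous hP.ratio_top (by positivity) fun a b hab hb hR => ?_
    have := hM ((a + b) / 2) (by linarith)
    linarith [hP.mul_length_le h12 h1 h2 hd hab hR]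
  have hI0 : 0 ≤ ∫ t in Set.Iic x, v t ^ p :=
    integral_nonneg fun t => Real.rpow_nonneg (hv t).le _
  have hJ0 : 0 ≤ ∫ t in Set.Ici x, u t ^ p' :=
    integral_nonneg fun t => Real.rpow_nonneg (hu t).le _
  have hupper : ∀ M N, 0 ≤ M → 0 ≤ N → (∀ y, y ≤ x → hF r d₁ d₂ y * d y ≤ M) →
      (∀ y, x ≤ y → hF r d₁ d₂ y * d y ≤ N) →
      thetaP u v p x ≤ C * M ^ (1 / p) * N ^ (1 / p') := by
    intro M N hM0 hN0 hM hN
    refine (conj_rpow_mul_le hpp hI0 hJ0 hK hK' hM0 hN0 (hu x) (hv x) (hleft M hM0 hM).2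
      (hright N hN0 hN).2).trans ?_
    gcongr
    exact le_max_right _ _
  have hBle : ∀ y, hF r d₁ d₂ y * d y ≤ ⨆ y : ℝ, hF r d₁ d₂ y * d y := fun y => le_ciSup hB y
  have hB0 : 0 ≤ ⨆ y : ℝ, hF r d₁ d₂ y * d y := (hhd x).le.trans (hBle x)
  have hsub : ∀ s : Set ℝ, BddAbove (Set.range fun t : s => hF r d₁ d₂ ↑t * d ↑t) := fun s =>
    hB.mono (by rintro _ ⟨t, rfl⟩; exact ⟨t, rfl⟩)
  refine ⟨?_, fun _ => ?_, fun _ => ?_⟩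
  · have hd0 := (hd x).1
    have hIle : d x * (v x / 32) ^ p ≤ ∫ t in Set.Iic x, v t ^ p := by
      have h := length_mul_le_setIntegral (a := x - d x) (b := x) (c := (v x / 32) ^ p)
        (hleft _ hB0 fun y _ => hBle y).1
        (fun t => Real.rpow_nonneg (hv t).le _) (by linarith) Set.Icc_subset_Iic_self ?_
      · simpa using h
      · intro t ht
        have e := hP.v_le h12 h1 h2 hd x
        have e2 := hP.v_monotone ht.1
        exact Real.rpow_le_rpow (by have := hv x; positivity) (by linarith) (by linarith)
    have hJle : d x * (u x / 32) ^ p' ≤ ∫ t in Set.Ici x, u t ^ p' := by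
      have h := length_mul_le_setIntegral (a := x) (b := x + d x) (c := (u x / 32) ^ p')
        (hright _ hB0 fun y _ => hBle y).1
        (fun t => Real.rpow_nonneg (hu t).le _) (by linarith) Set.Icc_subset_Ici_self ?_
      · simpa using h
      · intro t ht
        have e := hP.u_le h12 h1 h2 hd x
        have e2 := hP.u_antitone ht.2
        exact Real.rpow_le_rpow (by have := hu x; positivity) (by linarith) (by linarith)
    have hux := hu x
    have hvx := hv x
    have hlow := le_conj_rpow_mul hpp hd0.le (by positivity) (by positivity) hIle hJle
    refine le_trans ?_ hlow
    have hC : (2048 : ℝ) ≤ C := le_max_left _ _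
    have hh := mul_le_mul_of_nonneg_right (hP.hF_bounds h12 h1 h2 x).2.1 hd0.le
    rw [inv_mul_le_iff₀ (by linarith)]
    have hnn : 0 ≤ d x * (u x / 32 * (v x / 32)) := by positivity
    have := mul_le_mul_of_nonneg_right hC hnn
    linarith
  · have hS : ∀ y, x ≤ y → hF r d₁ d₂ y * d y ≤
        ⨆ t : Set.Ici x, hF r d₁ d₂ ↑t * d ↑t := fun y hy =>
      le_ciSup (hsub (Set.Ici x)) (⟨y, hy⟩ : Set.Ici x)
    exact hupper _ _ hB0 ((hhd x).le.trans (hS x le_rfl)) (fun y _ => hBle y) hS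
  · have hS : ∀ y, y ≤ x → hF r d₁ d₂ y * d y ≤
        ⨆ t : Set.Iic x, hF r d₁ d₂ ↑t * d ↑t := fun y hy =>
      le_ciSup (hsub (Set.Iic x)) (⟨y, hy⟩ : Set.Iic x)
    rw [mul_right_comm]
    exact hupper _ _ ((hhd x).le.trans (hS x le_rfl)) hB0 hS (fun y _ => hBle y)
end
end

section
/- Assume conditions (1.2) and (1.3), and let u, v be a principal fundamental system of solutions of (r z')' = q z. Then the two equalities lim_{|x|→∞} (u(x)/v(x)) ∫_{-∞}^x v(t)² dt = 0 and lim_{|x|→∞} (v(x)/u(x)) ∫_x^∞ u(t)² dt = 0 hold if and only if h(x) d(x) → 0 as |x| → ∞. -/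
open MeasureTheory Filter Topology
open scoped ENNReal RealInnerProductSpace

noncomputable section

/-- Postcomposition with a Lipschitz function preserves absolute continuity. -/
lemma lipschitzOnWith_comp_absolutelyContinuousOnInterval {f g : ℝ → ℝ} {K : NNReal} {a b : ℝ}
    (hg : LipschitzOnWith K g (f '' Set.uIcc a b)) (hf : AbsolutelyContinuousOnInterval f a b) :
    AbsolutelyContinuousOnInterval (fun x => g (f x)) a b := by
  rw [absolutelyContinuousOnInterval_iff] at hf ⊢
  intro ε hε
  obtain ⟨δ, hδ, H⟩ := hf (ε / (K + 1)) (by positivity)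
  refine ⟨δ, hδ, fun E hE hlt => ?_⟩
  have hsum := H E hE hlt
  calc ∑ i ∈ Finset.range E.1, dist (g (f (E.2 i).1)) (g (f (E.2 i).2))
      ≤ ∑ i ∈ Finset.range E.1, K * dist (f (E.2 i).1) (f (E.2 i).2) := by
        refine Finset.sum_le_sum fun i hi => ?_
        have := hE.1 i hi
        exact hg.dist_le_mul _ ⟨_, this.1, rfl⟩ _ ⟨_, this.2, rfl⟩
    _ = K * ∑ i ∈ Finset.range E.1, dist (f (E.2 i).1) (f (E.2 i).2) := by
        rw [Finset.mul_sum]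
    _ ≤ K * (ε / (K + 1)) := by gcongr
    _ < ε := by
        rw [mul_div_assoc', div_lt_iff₀ (by positivity)]
        nlinarith [K.coe_nonneg]

/-- The logarithm of a positive primitive `f` of `f'` is a primitive of `f' / f`. -/
lemma log_sub_log_eq_integral {f f' : ℝ → ℝ} (hpos : ∀ x, 0 < f x)
    (hint : ∀ a b, IntervalIntegrable f' volume a b)
    (hf : ∀ a b, f b - f a = ∫ t in a..b, f' t) (a b : ℝ) :
    IntervalIntegrable (fun t => f' t / f t) volume a b ∧
      Real.log (f b) - Real.log (f a) = ∫ t in a..b, f' t / f t := by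
  have hfeq : f = fun x => f a + ∫ t in a..x, f' t := by
    funext x; rw [← hf]; ring
  have hcont : Continuous f := by
    rw [hfeq]; exact continuous_const.add (intervalIntegral.continuous_primitive hint a)
  have hac : AbsolutelyContinuousOnInterval f a b := by
    rw [hfeq]
    refine AbsolutelyContinuousOnInterval.add ?_
      ((hint a b).absolutelyContinuousOnInterval_intervalIntegral Set.left_mem_uIcc)
    exact (LipschitzWith.const (f a)).lipschitzOnWith.absolutelyContinuousOnInterval
  obtain ⟨m, hm, hmin⟩ := isCompact_uIcc.exists_isMinOn (Set.nonempty_uIcc (a := a) (b := b))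
    hcont.continuousOn
  have hlip : LipschitzOnWith (Real.toNNReal (1 / f m)) Real.log (f '' Set.uIcc a b) := by
    refine LipschitzOnWith.mono ?_ (t := Set.Ici (f m)) ?_
    · refine Convex.lipschitzOnWith_of_nnnorm_deriv_le (𝕜 := ℝ) ?_ ?_ (convex_Ici _)
      · intro y hy
        exact Real.differentiableAt_log (((hpos m).trans_le hy).ne')
      · intro y hy
        have hy' := (hpos m).trans_le hy
        rw [Real.deriv_log, ← NNReal.coe_le_coe, coe_nnnorm, Real.norm_of_nonneg (by positivity),
          Real.coe_toNNReal _ (one_div_nonneg.2 (hpos m).le), ← one_div]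
        exact one_div_le_one_div_of_le (hpos m) hy
    · rintro _ ⟨y, hy, rfl⟩
      exact hmin hy
  have hlac := lipschitzOnWith_comp_absolutelyContinuousOnInterval hlip hac
  refine ⟨?_, ?_⟩
  · simp_rw [div_eq_mul_inv]
    exact (hint a b).mul_continuousOn (hcont.inv₀ fun x => (hpos x).ne').continuousOn
  · rw [← hlac.integral_deriv_eq_sub]
    refine intervalIntegral.integral_congr_ae ?_
    filter_upwards [(hint a b).ae_hasDerivAt_integral] with x hx hxm
    have h1 := hx (Set.uIoc_subset_uIcc hxm) a Set.left_mem_uIcc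
    have h2 : HasDerivAt f (f' x) x := by
      rw [hfeq]; exact h1.const_add _
    exact (h2.log (hpos x).ne').deriv

/-- If `v / u` grows by more than a factor `c > 1` over every interval centred at `m` of radius
larger than `d m`, then a bound on `u v d` controls `(u / v)(x) ∫_a^x v²`. -/
lemma div_mul_integral_sq_le {u v d : ℝ → ℝ} {c ε a x : ℝ} (hu : ∀ x, 0 < u x)
    (hv : ∀ x, 0 < v x) (huc : Continuous u) (hvc : Continuous v) (hua : Antitone u)
    (hvm : Monotone v) (hc : 1 < c)
    (hd : ∀ m s, v (m + s) / u (m + s) ≤ c * (v (m - s) / u (m - s)) → s ≤ d m)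
    (hax : a ≤ x) (hε : ∀ y ∈ Set.Icc a x, u y * v y * d y ≤ ε) :
    u x / v x * ∫ t in a..x, v t ^ 2 ≤ 2 * c ^ 2 / (c - 1) * ε := by
  have hc0 : 0 < c := by linarith
  set R : ℝ → ℝ := fun y => v y / u y with hR
  have hRpos : ∀ y, 0 < R y := fun y => div_pos (hv y) (hu y)
  have hRc : Continuous R := hvc.div huc fun y => (hu y).ne'
  have hRm : Monotone R := fun y z hyz =>
    div_le_div₀ (hv z).le (hvm hyz) (hu z) (hua hyz)
  have hvi : ∀ y z, IntervalIntegrable (fun t => v t ^ 2) volume y z := fun y z =>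
    (hvc.pow 2).intervalIntegrable y z
  set J : ℝ → ℝ := fun y => (R y)⁻¹ * ∫ t in a..y, v t ^ 2 with hJ
  have hJc : Continuous J :=
    (hRc.inv₀ fun y => (hRpos y).ne').mul (intervalIntegral.continuous_primitive hvi a)
  have hJnn : ∀ y, a ≤ y → 0 ≤ J y := fun y hy =>
    mul_nonneg (inv_nonneg.2 (hRpos y).le)
      (intervalIntegral.integral_nonneg hy fun t _ => sq_nonneg _)
  obtain ⟨y, hy, hmax⟩ := isCompact_Icc.exists_isMaxOn (Set.nonempty_Icc.2 hax) hJc.continuousOn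
  obtain ⟨z, hz, hRz, hJz⟩ : ∃ z ∈ Set.Icc a y, R y ≤ c * R z ∧
      (R y)⁻¹ * ∫ t in a..z, v t ^ 2 ≤ c⁻¹ * J y := by
    by_cases hcase : R y ≤ c * R a
    · refine ⟨a, ⟨le_rfl, hy.1⟩, hcase, ?_⟩
      simpa using mul_nonneg (inv_nonneg.2 hc0.le) (hJnn y hy.1)
    · have hmem : R y / c ∈ Set.Icc (R a) (R y) := by
        refine ⟨?_, div_le_self (hRpos y).le hc.le⟩
        rw [le_div_iff₀ hc0]; linarith
      obtain ⟨z, hz, hzeq⟩ := intermediate_value_Icc hy.1 hRc.continuousOn hmem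
      have hRy : R y = c * R z := by rw [hzeq]; field_simp
      refine ⟨z, hz, hRy.le, ?_⟩
      have : (R y)⁻¹ * ∫ t in a..z, v t ^ 2 = c⁻¹ * J z := by
        simp only [hJ]; rw [hRy, mul_inv, mul_assoc]
      rw [this]
      exact mul_le_mul_of_nonneg_left (hmax ⟨hz.1, hz.2.trans hy.2⟩) (inv_nonneg.2 hc0.le)
  have hlast : (R y)⁻¹ * ∫ t in z..y, v t ^ 2 ≤ 2 * c * ε := by
    have h1 : ∫ t in z..y, v t ^ 2 ≤ v y ^ 2 * (y - z) := by
      calc ∫ t in z..y, v t ^ 2 ≤ ∫ _ in z..y, v y ^ 2 :=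
            intervalIntegral.integral_mono_on hz.2 (hvi _ _) (by simp) fun t ht =>
              pow_le_pow_left₀ (hv t).le (hvm ht.2) 2
        _ = v y ^ 2 * (y - z) := by simp [mul_comm]
    set m := (z + y) / 2 with hm
    have hzm : z ≤ m := by linarith [hz.2]
    have hmy : m ≤ y := by linarith [hz.2]
    have hs : (y - z) / 2 ≤ d m := by
      refine hd m _ ?_
      rw [show m + (y - z) / 2 = y by rw [hm]; ring, show m - (y - z) / 2 = z by rw [hm]; ring]
      exact hRz
    have hvy : v y ≤ c * v m := by
      calc v y = R y * u y := by simp only [hR]; field_simp [(hu y).ne']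
        _ ≤ (c * R m) * u m :=
          mul_le_mul (hRz.trans (mul_le_mul_of_nonneg_left (hRm hzm) hc0.le)) (hua hmy)
            (hu y).le (mul_nonneg hc0.le (hRpos m).le)
        _ = c * v m := by simp only [hR]; field_simp [(hu m).ne']
    have hdm : 0 ≤ d m := by linarith [hz.2]
    calc (R y)⁻¹ * ∫ t in z..y, v t ^ 2 ≤ (R y)⁻¹ * (v y ^ 2 * (y - z)) :=
          mul_le_mul_of_nonneg_left h1 (inv_nonneg.2 (hRpos y).le)
      _ = u y * v y * (y - z) := by
          simp only [hR]; field_simp [(hu y).ne', (hv y).ne']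
      _ ≤ u m * (c * v m) * (2 * d m) := by
          refine mul_le_mul (mul_le_mul (hua hmy) hvy (hv y).le (hu m).le) (by linarith)
            (by linarith [hz.2]) ?_
          exact mul_nonneg (hu m).le (mul_nonneg hc0.le (hv m).le)
      _ = 2 * c * (u m * v m * d m) := by ring
      _ ≤ 2 * c * ε :=
          mul_le_mul_of_nonneg_left (hε m ⟨hz.1.trans hzm, hmy.trans hy.2⟩) (by positivity)
  have hJy : J y ≤ c⁻¹ * J y + 2 * c * ε := by
    calc J y = (R y)⁻¹ * (∫ t in a..z, v t ^ 2) + (R y)⁻¹ * ∫ t in z..y, v t ^ 2 := by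
          simp only [hJ]
          rw [← mul_add, intervalIntegral.integral_add_adjacent_intervals (hvi _ _) (hvi _ _)]
      _ ≤ _ := add_le_add hJz hlast
  have hJx : u x / v x * ∫ t in a..x, v t ^ 2 ≤ J y := by
    have := hmax (Set.right_mem_Icc.2 hax)
    simpa [hJ, hR] using this
  refine hJx.trans ?_
  rw [div_mul_eq_mul_div, le_div_iff₀ (by linarith)]
  have h2 : c * J y ≤ J y + 2 * c ^ 2 * ε := by
    calc c * J y ≤ c * (c⁻¹ * J y + 2 * c * ε) := mul_le_mul_of_nonneg_left hJy hc0.le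
      _ = J y + 2 * c ^ 2 * ε := by field_simp
  linarith

lemma lintegral_sq_Ioc_eq {v : ℝ → ℝ} (hvc : Continuous v) {a x : ℝ} (hax : a ≤ x) :
    ∫⁻ t in Set.Ioc a x, ENNReal.ofReal (v t ^ 2) = ENNReal.ofReal (∫ t in a..x, v t ^ 2) := by
  rw [intervalIntegral.integral_of_le hax, ofReal_integral_eq_lintegral_ofReal]
  · exact (intervalIntegrable_iff_integrableOn_Ioc_of_le hax).1 ((hvc.pow 2).intervalIntegrable a x)
  · exact ae_of_all _ fun t => sq_nonneg _

lemma ofReal_div_mul_lintegral_sq_Iic_le {u v d : ℝ → ℝ} {c ε x : ℝ} (hu : ∀ x, 0 < u x)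
    (hv : ∀ x, 0 < v x) (huc : Continuous u) (hvc : Continuous v) (hua : Antitone u)
    (hvm : Monotone v) (hc : 1 < c)
    (hd : ∀ m s, v (m + s) / u (m + s) ≤ c * (v (m - s) / u (m - s)) → s ≤ d m)
    (hε : ∀ y ≤ x, u y * v y * d y ≤ ε) :
    ENNReal.ofReal (u x / v x) * ∫⁻ t in Set.Iic x, ENNReal.ofReal (v t ^ 2) ≤
      ENNReal.ofReal (2 * c ^ 2 / (c - 1) * ε) := by
  have hcov : AECover (volume.restrict (Set.Iic x)) atBot fun a : ℝ => Set.Ioi a :=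
    (aecover_Ioi tendsto_id).mono Measure.restrict_le_self
  have htend := hcov.lintegral_tendsto_of_countably_generated
    (f := fun t => ENNReal.ofReal (v t ^ 2)) (by fun_prop)
  refine le_of_tendsto (ENNReal.Tendsto.const_mul htend (Or.inr ENNReal.ofReal_ne_top)) ?_
  filter_upwards [eventually_le_atBot x] with a ha
  rw [Measure.restrict_restrict measurableSet_Ioi, Set.Ioi_inter_Iic, lintegral_sq_Ioc_eq hvc ha,
    ← ENNReal.ofReal_mul (div_pos (hu x) (hv x)).le]
  exact ENNReal.ofReal_le_ofReal
    (div_mul_integral_sq_le hu hv huc hvc hua hvm hc hd ha fun y hy => hε y hy.2)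

/-- If `u v d` vanishes at infinity, so does `(u / v)(x) ∫_{-∞}^x v²`. -/
lemma tendsto_ofReal_div_mul_lintegral_sq_Iic {u v d : ℝ → ℝ} {c : ℝ} (hu : ∀ x, 0 < u x)
    (hv : ∀ x, 0 < v x) (huc : Continuous u) (hvc : Continuous v) (hua : Antitone u)
    (hvm : Monotone v) (hc : 1 < c)
    (hd : ∀ m s, v (m + s) / u (m + s) ≤ c * (v (m - s) / u (m - s)) → s ≤ d m)
    (htop : Tendsto (fun x => u x / v x) atTop (𝓝 0))
    (hlim : Tendsto (fun x => u x * v x * d x) (cocompact ℝ) (𝓝 0)) :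
    Tendsto (fun x => ENNReal.ofReal (u x / v x) *
      ∫⁻ t in Set.Iic x, ENNReal.ofReal (v t ^ 2)) (cocompact ℝ) (𝓝 0) := by
  rw [cocompact_eq_atBot_atTop, tendsto_sup] at hlim ⊢
  set K : ℝ := 2 * c ^ 2 / (c - 1) with hK
  have hKpos : 0 < K := div_pos (by positivity) (by linarith)
  have hbot : ∀ ε > 0, ∃ M, ∀ x ≤ M, ENNReal.ofReal (u x / v x) *
      ∫⁻ t in Set.Iic x, ENNReal.ofReal (v t ^ 2) ≤ ENNReal.ofReal (K * ε) := by
    intro ε hε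
    obtain ⟨M, hM⟩ := eventually_atBot.1 (hlim.1.eventually (gt_mem_nhds hε))
    exact ⟨M, fun x hx => ofReal_div_mul_lintegral_sq_Iic_le hu hv huc hvc hua hvm hc hd
      fun y hy => (hM y (hy.trans hx)).le⟩
  have hfin : ∀ M, ∫⁻ t in Set.Iic M, ENNReal.ofReal (v t ^ 2) < ⊤ := by
    intro M
    obtain ⟨N, hN⟩ := hbot 1 one_pos
    have hmin : ∫⁻ t in Set.Iic (min M N), ENNReal.ofReal (v t ^ 2) < ⊤ := by
      by_contra hcon
      have h1 := hN (min M N) (min_le_right _ _)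
      rw [not_lt_top_iff.1 hcon, ENNReal.mul_top
        (ENNReal.ofReal_pos.2 (div_pos (hu _) (hv _))).ne'] at h1
      exact ENNReal.ofReal_ne_top (top_le_iff.1 h1)
    rw [← Set.Iic_union_Ioc_eq_Iic (min_le_left M N)]
    refine (lintegral_union_le _ _ _).trans_lt (ENNReal.add_lt_top.2 ⟨hmin, ?_⟩)
    rw [lintegral_sq_Ioc_eq hvc (min_le_left M N)]
    exact ENNReal.ofReal_lt_top
  have hsmall : ∀ e : ℝ≥0∞, 0 < e → ∃ ε > 0, ENNReal.ofReal (K * ε) ≤ e := by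
    intro e he
    rcases eq_or_ne e ⊤ with rfl | he'
    · exact ⟨1, one_pos, le_top⟩
    · refine ⟨e.toReal / K, div_pos (ENNReal.toReal_pos he.ne' he') hKpos, ?_⟩
      rw [mul_div_cancel₀ _ hKpos.ne', ENNReal.ofReal_toReal he']
  refine ⟨ENNReal.tendsto_nhds_zero.2 fun e he => ?_, ENNReal.tendsto_nhds_zero.2 fun e he => ?_⟩
  · obtain ⟨ε, hε, hεe⟩ := hsmall e he
    obtain ⟨M, hM⟩ := hbot ε hε
    exact eventually_atBot.2 ⟨M, fun x hx => (hM x hx).trans hεe⟩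
  · obtain ⟨ε, hε, hεe⟩ := hsmall (e / 2) (ENNReal.half_pos he.ne')
    obtain ⟨M, hM⟩ := eventually_atTop.1 (hlim.2.eventually (gt_mem_nhds hε))
    have hzero : Tendsto (fun x => ENNReal.ofReal (u x / v x) *
        ∫⁻ t in Set.Iic M, ENNReal.ofReal (v t ^ 2)) atTop (𝓝 0) := by
      have h1 := ENNReal.tendsto_ofReal htop
      rw [ENNReal.ofReal_zero] at h1
      simpa using ENNReal.Tendsto.mul_const h1 (Or.inr (hfin M).ne)
    filter_upwards [ENNReal.tendsto_nhds_zero.1 hzero (e / 2) (ENNReal.half_pos he.ne'),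
      eventually_ge_atTop M] with x hx hMx
    rw [← Set.Iic_union_Ioc_eq_Iic hMx]
    calc ENNReal.ofReal (u x / v x) *
          ∫⁻ t in Set.Iic M ∪ Set.Ioc M x, ENNReal.ofReal (v t ^ 2)
        ≤ ENNReal.ofReal (u x / v x) * (∫⁻ t in Set.Iic M, ENNReal.ofReal (v t ^ 2)) +
          ENNReal.ofReal (u x / v x) * ∫⁻ t in Set.Ioc M x, ENNReal.ofReal (v t ^ 2) := by
          rw [← mul_add]; gcongr; exact lintegral_union_le _ _ _
      _ ≤ e / 2 + e / 2 := by
          refine add_le_add hx (le_trans ?_ hεe)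
          rw [lintegral_sq_Ioc_eq hvc hMx, ← ENNReal.ofReal_mul (div_pos (hu x) (hv x)).le]
          exact ENNReal.ofReal_le_ofReal (div_mul_integral_sq_le hu hv huc hvc hua hvm hc hd hMx
            fun y hy => (hM y hy.1).le)
      _ = e := ENNReal.add_halves e

/-- The mirror image of `tendsto_ofReal_div_mul_lintegral_sq_Iic`. -/
lemma tendsto_ofReal_div_mul_lintegral_sq_Ici {u v d : ℝ → ℝ} {c : ℝ} (hu : ∀ x, 0 < u x)
    (hv : ∀ x, 0 < v x) (huc : Continuous u) (hvc : Continuous v) (hua : Antitone u)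
    (hvm : Monotone v) (hc : 1 < c)
    (hd : ∀ m s, v (m + s) / u (m + s) ≤ c * (v (m - s) / u (m - s)) → s ≤ d m)
    (hbot : Tendsto (fun x => v x / u x) atBot (𝓝 0))
    (hlim : Tendsto (fun x => u x * v x * d x) (cocompact ℝ) (𝓝 0)) :
    Tendsto (fun x => ENNReal.ofReal (v x / u x) *
      ∫⁻ t in Set.Ici x, ENNReal.ofReal (u t ^ 2)) (cocompact ℝ) (𝓝 0) := by
  have hneg : Tendsto (fun x : ℝ => -x) (cocompact ℝ) (cocompact ℝ) :=
    (Homeomorph.neg ℝ).isClosedEmbedding.tendsto_cocompact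
  have key := tendsto_ofReal_div_mul_lintegral_sq_Iic (u := fun x => v (-x)) (v := fun x => u (-x))
    (d := fun x => d (-x)) (c := c) (fun x => hv _) (fun x => hu _) (hvc.comp continuous_neg)
    (huc.comp continuous_neg) (fun x y hxy => hvm (neg_le_neg hxy))
    (fun x y hxy => hua (neg_le_neg hxy)) hc ?_ (hbot.comp tendsto_neg_atTop_atBot) ?_
  · refine (key.comp hneg).congr fun x => ?_
    have hmp := (Measure.measurePreserving_neg (volume : Measure ℝ)).setLIntegral_comp_preimage_emb
      (Homeomorph.neg ℝ).measurableEmbedding (fun t => ENNReal.ofReal (u t ^ 2)) (Set.Ici x)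
    simp only [Function.comp, neg_neg]
    rw [← hmp]
    simp
  · intro m s h
    refine hd (-m) s ?_
    rw [show -m + s = -(m - s) by ring, show -m - s = -(m + s) by ring]
    rw [mul_div_assoc', div_le_div_iff₀ (hv _) (hv _)] at h
    rw [mul_div_assoc', div_le_div_iff₀ (hu _) (hu _)]
    linarith
  · refine (hlim.comp hneg).congr fun x => ?_
    simp only [Function.comp]; ring

/-- If `v / u` grows by at most a factor `c` over the interval of radius `d x` centred at `x`,
then `u v d` is controlled by `(u / v)(x) ∫_{-∞}^x v²`. -/
lemma ofReal_mul_le_div_mul_lintegral_sq_Iic {u v d : ℝ → ℝ} {c x : ℝ} (hu : ∀ x, 0 < u x)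
    (hv : ∀ x, 0 < v x) (hua : Antitone u) (hvm : Monotone v) (hc : 0 < c) (hdx : 0 ≤ d x)
    (hd : v (x + d x) / u (x + d x) ≤ c * (v (x - d x) / u (x - d x))) :
    ENNReal.ofReal (u x * v x * d x / c ^ 2) ≤ ENNReal.ofReal (u x / v x) *
      ∫⁻ t in Set.Iic x, ENNReal.ofReal (v t ^ 2) := by
  have hRm : Monotone fun y => v y / u y := fun y z hyz =>
    div_le_div₀ (hv z).le (hvm hyz) (hu z) (hua hyz)
  have hle : ∀ t ∈ Set.Ioc (x - d x) x, v x / c ≤ v t := by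
    intro t ht
    rw [div_le_iff₀' hc]
    have h1 : v x / u x ≤ c * (v t / u t) :=
      (hRm (by linarith : x ≤ x + d x)).trans
        (hd.trans (mul_le_mul_of_nonneg_left (hRm ht.1.le) hc.le))
    calc v x = v x / u x * u x := by field_simp [(hu x).ne']
      _ ≤ c * (v t / u t) * u t :=
        mul_le_mul h1 (hua ht.2) (hu x).le (mul_nonneg hc.le (div_pos (hv t) (hu t)).le)
      _ = c * v t := by field_simp [(hu t).ne']
  calc ENNReal.ofReal (u x * v x * d x / c ^ 2)
      = ENNReal.ofReal (u x / v x) *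
          ∫⁻ _ in Set.Ioc (x - d x) x, ENNReal.ofReal ((v x / c) ^ 2) := by
        rw [setLIntegral_const, Real.volume_Ioc, ← ENNReal.ofReal_mul (by positivity),
          ← ENNReal.ofReal_mul (div_pos (hu x) (hv x)).le]
        congr 1
        have := (hv x).ne'
        field_simp
        ring
    _ ≤ ENNReal.ofReal (u x / v x) * ∫⁻ t in Set.Ioc (x - d x) x, ENNReal.ofReal (v t ^ 2) := by
        refine mul_le_mul' le_rfl ?_
        refine setLIntegral_mono' measurableSet_Ioc fun t ht => ENNReal.ofReal_le_ofReal ?_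
        exact pow_le_pow_left₀ (div_pos (hv x) hc).le (hle t ht) 2
    _ ≤ _ := by
        refine mul_le_mul' le_rfl ?_
        exact lintegral_mono_set Set.Ioc_subset_Iic_self

lemma mul_integral_le_integral_mul {f g : ℝ → ℝ} {a b m : ℝ} (hab : a ≤ b)
    (hg : IntervalIntegrable g volume a b) (hgf : IntervalIntegrable (fun t => g t * f t) volume a b)
    (hg0 : ∀ t, 0 ≤ g t) (hm : ∀ t ∈ Set.Icc a b, m ≤ f t) :
    m * ∫ t in a..b, g t ≤ ∫ t in a..b, g t * f t := by
  rw [← intervalIntegral.integral_const_mul]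
  refine intervalIntegral.integral_mono_on hab (hg.const_mul m) hgf fun t ht => ?_
  rw [mul_comm]
  exact mul_le_mul_of_nonneg_left (hm t ht) (hg0 t)

lemma integral_mul_le_mul_integral {f g : ℝ → ℝ} {a b M : ℝ} (hab : a ≤ b)
    (hg : IntervalIntegrable g volume a b) (hgf : IntervalIntegrable (fun t => g t * f t) volume a b)
    (hg0 : ∀ t, 0 ≤ g t) (hM : ∀ t ∈ Set.Icc a b, f t ≤ M) :
    ∫ t in a..b, g t * f t ≤ M * ∫ t in a..b, g t := by
  rw [← intervalIntegral.integral_const_mul]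
  refine intervalIntegral.integral_mono_on hab hgf (hg.const_mul M) fun t ht => ?_
  rw [mul_comm M]
  exact mul_le_mul_of_nonneg_left (hM t ht) (hg0 t)

/-- Two-sided comparison of `P / V` with `1 / Φ` from increments of `V` and `P`, where `Q = 1 / Φ`
bounds the relative increment of `P`. -/
lemma half_inv_le_div_le_two_mul_inv {V α P p Φ Q : ℝ} (hV : 0 < V) (hα : 0 ≤ α) (hΦ : 0 < Φ)
    (hΦQ : Φ * Q = 1) (hp : 0 ≤ p) (h1 : V - α ≤ P * Φ) (h2 : p * Φ ≤ V - α)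
    (h3 : α * Q ≤ P - p) (h4 : P - p ≤ V * Q) :
    1 / 2 * Φ⁻¹ ≤ P / V ∧ P / V ≤ 2 * Φ⁻¹ := by
  have hQ : Q = Φ⁻¹ := eq_inv_of_mul_eq_one_right hΦQ
  have h3' : α ≤ P * Φ := by
    have := mul_le_mul_of_nonneg_right h3 hΦ.le
    rw [hQ, mul_assoc, inv_mul_cancel₀ hΦ.ne'] at this
    nlinarith
  have h4' : P * Φ - p * Φ ≤ V := by
    have := mul_le_mul_of_nonneg_right h4 hΦ.le
    rw [hQ, mul_assoc, inv_mul_cancel₀ hΦ.ne'] at this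
    linarith
  rw [← div_eq_mul_inv, ← div_eq_mul_inv, div_le_div_iff₀ hΦ hV, div_le_div_iff₀ hV hΦ]
  constructor <;> linarith

namespace PFSS

variable {r q u v u' v' : ℝ → ℝ}

lemma continuous_u (H : PFSS r q u v u' v') : Continuous u := by
  have : u = fun x => u 0 + ∫ t in (0 : ℝ)..x, u' t := by
    funext x; rw [← H.u_deriv]; ring
  rw [this]
  exact continuous_const.add (intervalIntegral.continuous_primitive H.u'_intble 0)

lemma continuous_v (H : PFSS r q u v u' v') : Continuous v := by
  have : v = fun x => v 0 + ∫ t in (0 : ℝ)..x, v' t := by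
    funext x; rw [← H.v_deriv]; ring
  rw [this]
  exact continuous_const.add (intervalIntegral.continuous_primitive H.v'_intble 0)

lemma antitone_u (H : PFSS r q u v u' v') : Antitone u := by
  intro a b hab
  have h1 := H.u_deriv a b
  have h2 := intervalIntegral.integral_mono_on hab (H.u'_intble a b)
    (intervalIntegrable_const (c := (0 : ℝ))) fun t _ => H.u'_nonpos t
  simp only [intervalIntegral.integral_zero] at h2
  linarith

lemma monotone_v (H : PFSS r q u v u' v') : Monotone v := by
  intro a b hab
  have h1 := H.v_deriv a b
  have h2 := intervalIntegral.integral_nonneg (μ := volume) hab fun t (_ : t ∈ Set.Icc a b) => H.v'_nonneg t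
  linarith

lemma monotone_r_mul_v' (H : PFSS r q u v u' v') (hq : ∀ x, 0 ≤ q x) :
    Monotone fun x => r x * v' x := by
  intro a b hab
  have h1 := H.rv'_deriv a b
  have h2 := intervalIntegral.integral_nonneg (μ := volume) hab
    fun t (_ : t ∈ Set.Icc a b) => mul_nonneg (hq t) (H.v_pos t).le
  show r a * v' a ≤ r b * v' b
  linarith

lemma monotone_r_mul_u' (H : PFSS r q u v u' v') (hq : ∀ x, 0 ≤ q x) :
    Monotone fun x => r x * u' x := by
  intro a b hab
  have h1 := H.ru'_deriv a b
  have h2 := intervalIntegral.integral_nonneg (μ := volume) hab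
    fun t (_ : t ∈ Set.Icc a b) => mul_nonneg (hq t) (H.u_pos t).le
  show r a * u' a ≤ r b * u' b
  linarith

lemma v_logDeriv_bounds (H : PFSS r q u v u' v') (h12 : Cond12 r q) {a x : ℝ} (hax : a ≤ x)
    (h : (∫ t in a..x, 1 / r t) * (∫ t in a..x, q t) = 1) :
    0 < ∫ t in a..x, 1 / r t ∧
      1 / 2 * (∫ t in a..x, 1 / r t)⁻¹ ≤ r x * v' x / v x ∧
      r x * v' x / v x ≤ 2 * (∫ t in a..x, 1 / r t)⁻¹ := by
  obtain ⟨-, -, hr, hq, hri, hqi⟩ := h12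
  have hr0 : ∀ t, 0 ≤ 1 / r t := fun t => (one_div_pos.2 (hr t)).le
  have hΦ : 0 < ∫ t in a..x, 1 / r t :=
    (intervalIntegral.integral_nonneg hax fun t _ => hr0 t).lt_of_ne' fun h0 => by
      rw [h0, zero_mul] at h; exact zero_ne_one h
  have hri' : IntervalIntegrable (fun t => 1 / r t) volume a x :=
    (hri.integrableOn_isCompact isCompact_uIcc).intervalIntegrable
  have hqi' : IntervalIntegrable q volume a x :=
    (hqi.integrableOn_isCompact isCompact_uIcc).intervalIntegrable
  have hv'eq : v' = fun t => 1 / r t * (r t * v' t) := by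
    funext t; field_simp [(hr t).ne']
  have hv'i := H.v'_intble a x
  have hv'd := H.v_deriv a x
  rw [hv'eq] at hv'i hv'd
  have hqv : IntervalIntegrable (fun t => q t * v t) volume a x :=
    hqi'.mul_continuousOn H.continuous_v.continuousOn
  have hp := H.monotone_r_mul_v' hq
  refine ⟨hΦ, half_inv_le_div_le_two_mul_inv (α := v a) (p := r a * v' a) (H.v_pos x)
    (H.v_pos a).le hΦ h (mul_nonneg (hr a).le (H.v'_nonneg a)) ?_ ?_ ?_ ?_⟩
  · rw [hv'd]
    exact integral_mul_le_mul_integral hax hri' hv'i hr0 fun t ht => hp ht.2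
  · rw [hv'd]
    exact mul_integral_le_integral_mul hax hri' hv'i hr0 fun t ht => hp ht.1
  · rw [H.rv'_deriv]
    exact mul_integral_le_integral_mul hax hqi' hqv hq fun t ht => H.monotone_v ht.1
  · rw [H.rv'_deriv]
    exact integral_mul_le_mul_integral hax hqi' hqv hq fun t ht => H.monotone_v ht.2

lemma u_logDeriv_bounds (H : PFSS r q u v u' v') (h12 : Cond12 r q) {x b : ℝ} (hxb : x ≤ b)
    (h : (∫ t in x..b, 1 / r t) * (∫ t in x..b, q t) = 1) :
    0 < ∫ t in x..b, 1 / r t ∧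
      1 / 2 * (∫ t in x..b, 1 / r t)⁻¹ ≤ -(r x * u' x) / u x ∧
      -(r x * u' x) / u x ≤ 2 * (∫ t in x..b, 1 / r t)⁻¹ := by
  obtain ⟨-, -, hr, hq, hri, hqi⟩ := h12
  have hr0 : ∀ t, 0 ≤ 1 / r t := fun t => (one_div_pos.2 (hr t)).le
  have hΨ : 0 < ∫ t in x..b, 1 / r t :=
    (intervalIntegral.integral_nonneg hxb fun t _ => hr0 t).lt_of_ne' fun h0 => by
      rw [h0, zero_mul] at h; exact zero_ne_one h
  have hri' : IntervalIntegrable (fun t => 1 / r t) volume x b :=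
    (hri.integrableOn_isCompact isCompact_uIcc).intervalIntegrable
  have hqi' : IntervalIntegrable q volume x b :=
    (hqi.integrableOn_isCompact isCompact_uIcc).intervalIntegrable
  have hu'eq : (fun t => -u' t) = fun t => 1 / r t * -(r t * u' t) := by
    funext t; field_simp [(hr t).ne']
  have hu'i : IntervalIntegrable (fun t => -u' t) volume x b := (H.u'_intble x b).neg
  have hu'd : u x - u b = ∫ t in x..b, -u' t := by
    rw [intervalIntegral.integral_neg, ← H.u_deriv]; ring
  rw [hu'eq] at hu'i hu'd
  have hqu : IntervalIntegrable (fun t => q t * u t) volume x b :=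
    hqi'.mul_continuousOn H.continuous_u.continuousOn
  have hp := H.monotone_r_mul_u' hq
  have hrd : -(r x * u' x) - -(r b * u' b) = ∫ t in x..b, q t * u t := by
    rw [← H.ru'_deriv]; ring
  refine ⟨hΨ, half_inv_le_div_le_two_mul_inv (α := u b) (p := -(r b * u' b)) (H.u_pos x)
    (H.u_pos b).le hΨ h ?_ ?_ ?_ ?_ ?_⟩
  · exact neg_nonneg.2 (mul_nonpos_of_nonneg_of_nonpos (hr b).le (H.u'_nonpos b))
  · rw [hu'd]
    exact integral_mul_le_mul_integral hxb hri' hu'i hr0 fun t ht => neg_le_neg (hp ht.1)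
  · rw [hu'd]
    exact mul_integral_le_integral_mul hxb hri' hu'i hr0 fun t ht => neg_le_neg (hp ht.2)
  · rw [hrd]
    exact mul_integral_le_integral_mul hxb hqi' hqu hq fun t ht => H.antitone_u ht.2
  · rw [hrd]
    exact integral_mul_le_mul_integral hxb hqi' hqu hq fun t ht => H.antitone_u ht.1

/-- The product `u v` is comparable to `h`. -/
lemma hF_bounds_s13 (H : PFSS r q u v u' v') (h12 : Cond12 r q) {d₁ d₂ : ℝ → ℝ}
    (hd₁ : IsD1 r q d₁) (hd₂ : IsD2 r q d₂) (x : ℝ) :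
    0 < hF r d₁ d₂ x ∧ 1 / 2 * (hF r d₁ d₂ x)⁻¹ ≤ (u x * v x)⁻¹ ∧
      (u x * v x)⁻¹ ≤ 2 * (hF r d₁ d₂ x)⁻¹ := by
  obtain ⟨hφ, hv1, hv2⟩ := H.v_logDeriv_bounds h12 (by linarith [(hd₁ x).1]) (hd₁ x).2
  obtain ⟨hψ, hu1, hu2⟩ := H.u_logDeriv_bounds h12 (by linarith [(hd₂ x).1]) (hd₂ x).2
  have hinv : (hF r d₁ d₂ x)⁻¹ =
      (∫ t in x - d₁ x..x, 1 / r t)⁻¹ + (∫ t in x..x + d₂ x, 1 / r t)⁻¹ := by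
    unfold hF phiF psiF
    rw [inv_div, add_comm, add_div, div_mul_cancel_right₀ hψ.ne', div_mul_cancel_left₀ hφ.ne']
  have hW : (u x * v x)⁻¹ = r x * v' x / v x + -(r x * u' x) / u x := by
    have hu := (H.u_pos x).ne'
    have hv := (H.v_pos x).ne'
    rw [div_add_div _ _ hv hu, inv_eq_one_div, mul_comm (u x), ← H.wronskian x]
    congr 1; ring
  refine ⟨?_, ?_, ?_⟩
  · exact div_pos (mul_pos hφ hψ) (add_pos hφ hψ)
  · rw [hinv, hW]; linarith
  · rw [hinv, hW]; linarith

lemma log_ratio_sub (H : PFSS r q u v u' v') (h12 : Cond12 r q) (a b : ℝ) :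
    IntervalIntegrable (fun t => 1 / r t * (u t * v t)⁻¹) volume a b ∧
      Real.log (v b / u b) - Real.log (v a / u a) = ∫ t in a..b, 1 / r t * (u t * v t)⁻¹ := by
  obtain ⟨hui, hu⟩ := log_sub_log_eq_integral H.u_pos H.u'_intble H.u_deriv a b
  obtain ⟨hvi, hv⟩ := log_sub_log_eq_integral H.v_pos H.v'_intble H.v_deriv a b
  have heq : (fun t => 1 / r t * (u t * v t)⁻¹) = fun t => v' t / v t - u' t / u t := by
    funext t
    have h1 := (H.u_pos t).ne'
    have h2 := (H.v_pos t).ne'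
    have h3 := (h12.2.2.1 t).ne'
    have hw := H.wronskian t
    field_simp
    linarith
  rw [heq]
  refine ⟨hvi.sub hui, ?_⟩
  rw [intervalIntegral.integral_sub hvi hui, ← hu, ← hv,
    Real.log_div (H.v_pos b).ne' (H.u_pos b).ne', Real.log_div (H.v_pos a).ne' (H.u_pos a).ne']
  ring

/-- The logarithm of `v / u` increases by an amount between `1 / 2` and `2` over
`[x - d x, x + d x]`. -/
lemma log_ratio_bounds (H : PFSS r q u v u' v') (h12 : Cond12 r q) {d₁ d₂ d : ℝ → ℝ}
    (hd₁ : IsD1 r q d₁) (hd₂ : IsD2 r q d₂) (hd : IsD r (hF r d₁ d₂) d) (x : ℝ) :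
    1 / 2 ≤ Real.log (v (x + d x) / u (x + d x)) - Real.log (v (x - d x) / u (x - d x)) ∧
      Real.log (v (x + d x) / u (x + d x)) - Real.log (v (x - d x) / u (x - d x)) ≤ 2 := by
  obtain ⟨hdx, hint⟩ := hd x
  obtain ⟨hi, heq⟩ := H.log_ratio_sub h12 (x - d x) (x + d x)
  have hle : x - d x ≤ x + d x := by linarith
  have hhi : IntervalIntegrable (fun t => 1 / (r t * hF r d₁ d₂ t)) volume (x - d x) (x + d x) := by
    by_contra hcon
    rw [intervalIntegral.integral_undef hcon] at hint
    exact zero_ne_one hint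
  have hform : ∀ t, 1 / (r t * hF r d₁ d₂ t) = 1 / r t * (hF r d₁ d₂ t)⁻¹ := fun t => by
    rw [one_div, mul_inv, one_div]
  have hr0 : ∀ t, 0 ≤ 1 / r t := fun t => (one_div_pos.2 (h12.2.2.1 t)).le
  rw [heq]
  constructor
  · calc (1 : ℝ) / 2 = ∫ t in x - d x..x + d x, 1 / 2 * (1 / (r t * hF r d₁ d₂ t)) := by
          rw [intervalIntegral.integral_const_mul, hint, mul_one]
      _ ≤ _ := by
          refine intervalIntegral.integral_mono_on hle (hhi.const_mul _) hi fun t _ => ?_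
          rw [hform, mul_left_comm]
          exact mul_le_mul_of_nonneg_left (H.hF_bounds_s13 h12 hd₁ hd₂ t).2.1 (hr0 t)
  · calc _ ≤ ∫ t in x - d x..x + d x, 2 * (1 / (r t * hF r d₁ d₂ t)) := by
          refine intervalIntegral.integral_mono_on hle hi (hhi.const_mul _) fun t _ => ?_
          rw [hform, mul_left_comm]
          exact mul_le_mul_of_nonneg_left (H.hF_bounds_s13 h12 hd₁ hd₂ t).2.2 (hr0 t)
      _ = 2 := by rw [intervalIntegral.integral_const_mul, hint, mul_one]

end PFSS

/-- **Lemma 4.6.** Assume (1.2), (1.3) and let `u, v` be a principal FSS.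
Then `(u(x)/v(x)) ∫_{-∞}^x v² → 0` and `(v(x)/u(x)) ∫_x^∞ u² → 0` as
`|x| → ∞` if and only if `h(x) d(x) → 0` as `|x| → ∞`. -/
theorem limits_iff_hd_tendsto_zero
    (r q u v u' v' d₁ d₂ d : ℝ → ℝ)
    (h12 : Cond12 r q) (h13 : Cond13 r q) (hfss : PFSS r q u v u' v')
    (hd₁ : IsD1 r q d₁) (hd₂ : IsD2 r q d₂) (hd : IsD r (hF r d₁ d₂) d) :
    (Tendsto (fun x => ENNReal.ofReal (u x / v x) *
          ∫⁻ t in Set.Iic x, ENNReal.ofReal (v t ^ 2)) (cocompact ℝ)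
        (𝓝 (0 : ℝ≥0∞)) ∧
      Tendsto (fun x => ENNReal.ofReal (v x / u x) *
          ∫⁻ t in Set.Ici x, ENNReal.ofReal (u t ^ 2)) (cocompact ℝ)
        (𝓝 (0 : ℝ≥0∞))) ↔
      Tendsto (fun x => hF r d₁ d₂ x * d x) (cocompact ℝ) (𝓝 (0 : ℝ)) := by
  have hu := hfss.u_pos
  have hv := hfss.v_pos
  have hbd := hfss.hF_bounds_s13 h12 hd₁ hd₂
  have hlog := hfss.log_ratio_bounds h12 hd₁ hd₂ hd
  have hRpos : ∀ x, 0 < v x / u x := fun x => div_pos (hv x) (hu x)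
  have hRm : Monotone fun y => v y / u y := fun y z hyz =>
    div_le_div₀ (hv z).le (hfss.monotone_v hyz) (hu z) (hfss.antitone_u hyz)
  have huv : ∀ x, 0 < u x * v x := fun x => mul_pos (hu x) (hv x)
  have hle : ∀ x, u x * v x ≤ 2 * hF r d₁ d₂ x := fun x => by
    have h1 := (hbd x).2.1
    rw [← div_eq_mul_inv, ← one_div, div_le_div_iff₀ (hbd x).1 (huv x)] at h1
    linarith
  have hge : ∀ x, hF r d₁ d₂ x ≤ 2 * (u x * v x) := fun x => by
    have h1 := (hbd x).2.2
    rw [← div_eq_mul_inv, ← one_div, div_le_div_iff₀ (huv x) (hbd x).1] at h1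
    linarith
  constructor
  · rintro ⟨h1, -⟩
    have hlower : ∀ x, ENNReal.ofReal (u x * v x * d x / Real.exp 2 ^ 2) ≤
        ENNReal.ofReal (u x / v x) * ∫⁻ t in Set.Iic x, ENNReal.ofReal (v t ^ 2) := by
      intro x
      refine ofReal_mul_le_div_mul_lintegral_sq_Iic hu hv hfss.antitone_u hfss.monotone_v
        (Real.exp_pos 2) (hd x).1.le ?_
      rw [← Real.log_le_log_iff (hRpos _) (mul_pos (Real.exp_pos _) (hRpos _)),
        Real.log_mul (Real.exp_pos _).ne' (hRpos _).ne', Real.log_exp]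
      linarith [(hlog x).2]
    have h2 := tendsto_of_tendsto_of_tendsto_of_le_of_le tendsto_const_nhds h1
      (fun x => zero_le) hlower
    have h3 := (ENNReal.tendsto_toReal ENNReal.zero_ne_top).comp h2
    have h4 := h3.const_mul (2 * Real.exp 2 ^ 2)
    simp only [ENNReal.toReal_zero, mul_zero] at h4
    refine squeeze_zero (fun x => mul_nonneg (hbd x).1.le (hd x).1.le) (fun x => ?_) h4
    have hnn : 0 ≤ u x * v x * d x / Real.exp 2 ^ 2 :=
      div_nonneg (mul_nonneg (huv x).le (hd x).1.le) (sq_nonneg _)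
    simp only [Function.comp]
    rw [ENNReal.toReal_ofReal hnn, mul_assoc, mul_div_cancel₀ _ (by positivity), ← mul_assoc]
    exact mul_le_mul_of_nonneg_right (hge x) (hd x).1.le
  · intro h
    have hlim : Tendsto (fun x => u x * v x * d x) (cocompact ℝ) (𝓝 0) := by
      have h2 := h.const_mul 2
      rw [mul_zero] at h2
      refine squeeze_zero (fun x => mul_nonneg (huv x).le (hd x).1.le) (fun x => ?_) h2
      rw [← mul_assoc]
      exact mul_le_mul_of_nonneg_right (hle x) (hd x).1.le
    have hgrow : ∀ m s, v (m + s) / u (m + s) ≤ Real.exp (1 / 4) * (v (m - s) / u (m - s)) →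
        s ≤ d m := by
      intro m s hms
      by_contra! hlt
      rw [← Real.log_le_log_iff (hRpos _) (mul_pos (Real.exp_pos _) (hRpos _)),
        Real.log_mul (Real.exp_pos _).ne' (hRpos _).ne', Real.log_exp] at hms
      have e1 := Real.log_le_log (hRpos _) (hRm (by linarith : m + d m ≤ m + s))
      have e2 := Real.log_le_log (hRpos _) (hRm (by linarith : m - s ≤ m - d m))
      simp only at e1 e2
      linarith [(hlog m).1]
    have hc : 1 < Real.exp (1 / 4) := Real.one_lt_exp_iff.2 (by norm_num)
    exact ⟨tendsto_ofReal_div_mul_lintegral_sq_Iic hu hv hfss.continuous_u hfss.continuous_v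
        hfss.antitone_u hfss.monotone_v hc hgrow hfss.ratio_top hlim,
      tendsto_ofReal_div_mul_lintegral_sq_Ici hu hv hfss.continuous_u hfss.continuous_v
        hfss.antitone_u hfss.monotone_v hc hgrow hfss.ratio_bot hlim⟩
end
end
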